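/- arXiv:1508.07540 — 3 statements merged into one kernel-verified Lean document; each statement's English description precedes it below -/
import Mathlib

section
/- Let K be a field and n ≥ m ≥ 1 integers. Then the depth of the quotient S/I_{n,m} equals n + 1 − ⌊(n+1)/(m+1)⌋ − ⌈(n+1)/(m+1)⌉; i.e., the maximal length of an (S/I_{n,m})-regular sequence of homogeneous elements of the graded maximal ideal (x_1,…,x_n) is n + 1 − ⌊(n+1)/(m+1)⌋ − ⌈(n+1)/(m+1)⌉. -/
open MvPolynomial

/-- The generator `u_i = x_i x_{i+1} ⋯ x_{i+m-1}` of the path ideal, where the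
variables of `K[x_1,…,x_n]` are 1-indexed via `x_t = X ⟨t-1⟩`. -/
noncomputable def pathGen (K : Type) [Field K] (n m i : ℕ) : MvPolynomial (Fin n) K :=
  ∏ j ∈ Finset.univ.filter (fun j : Fin n => i ≤ (j : ℕ) + 1 ∧ (j : ℕ) + 1 < i + m),
    X j

/-- The monomial `u_i / x_p = ∏_{i ≤ l ≤ i+m-1, l ≠ p} x_l`. -/
noncomputable def pathGenDiv (K : Type) [Field K] (n m i p : ℕ) : MvPolynomial (Fin n) K :=
  ∏ j ∈ Finset.univ.filter
      (fun j : Fin n => (i ≤ (j : ℕ) + 1 ∧ (j : ℕ) + 1 < i + m) ∧ (j : ℕ) + 1 ≠ p),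
    X j

/-- The path ideal `I_{n,m} = (u_1, …, u_{n-m+1}) ⊆ K[x_1,…,x_n]` of the line graph. -/
noncomputable def pathIdeal (K : Type) [Field K] (n m : ℕ) : Ideal (MvPolynomial (Fin n) K) :=
  Ideal.span {q | ∃ i : ℕ, 1 ≤ i ∧ i ≤ n - m + 1 ∧ q = pathGen K n m i}

/-- The variable `x_t` of `K[x_1,…,x_n]` (1-indexed; junk value `0` out of range). -/
noncomputable def xv (K : Type) [Field K] (n t : ℕ) : MvPolynomial (Fin n) K :=
  if h : 1 ≤ t ∧ t ≤ n then X (⟨t - 1, by omega⟩ : Fin n) else 0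

/-- The set of lengths of `(S/I)`-regular sequences consisting of homogeneous
elements of the graded maximal ideal `(x_1,…,x_n)` of `S = K[x_1,…,x_n]`.
The depth of `S/I` is the greatest element of this set. -/
def homogRegSeqLengths (K : Type) [Field K] (n : ℕ)
    (I : Ideal (MvPolynomial (Fin n) K)) : Set ℕ :=
  {d | ∃ rs : List (MvPolynomial (Fin n) K), rs.length = d ∧
    (∀ f ∈ rs, (∃ e : ℕ, f.IsHomogeneous e) ∧
      f ∈ Ideal.span (Set.range (X : Fin n → MvPolynomial (Fin n) K))) ∧
    RingTheory.Sequence.IsRegular (MvPolynomial (Fin n) K ⧸ I) rs}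

namespace Ideal

variable {R : Type*} [CommRing R]

theorem mem_sup_span_singleton_iff {J : Ideal R} {a x : R} :
    x ∈ J ⊔ span {a} ↔ ∃ c, x - a * c ∈ J := by
  constructor
  · intro hx
    obtain ⟨j, hj, s, hs, rfl⟩ := Submodule.mem_sup.1 hx
    obtain ⟨c, rfl⟩ := mem_span_singleton'.1 hs
    exact ⟨c, by rwa [mul_comm c a, add_sub_cancel_right]⟩
  · rintro ⟨c, hc⟩
    rw [← sub_add_cancel x (a * c)]
    exact Ideal.add_mem _ (mem_sup_left hc)
      (mem_sup_right (mul_mem_right _ _ (mem_span_singleton_self a)))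

/-- The sequence `rs` is weakly regular on `R ⧸ J`, expressed in terms of ideals of `R`. -/
def IsRegularMod : Ideal R → List R → Prop
  | _, [] => True
  | J, r :: rs => (∀ g, r * g ∈ J → g ∈ J) ∧ (J ⊔ span {r}).IsRegularMod rs

namespace IsRegularMod

theorem append {rs ss : List R} {J : Ideal R} (h₁ : J.IsRegularMod rs)
    (h₂ : (J ⊔ ofList rs).IsRegularMod ss) : J.IsRegularMod (rs ++ ss) := by
  induction rs generalizing J with
  | nil => simpa using h₂
  | cons r rs ih =>
    refine ⟨h₁.1, ih h₁.2 ?_⟩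
    rwa [ofList_cons, ← sup_assoc] at h₂

open scoped Pointwise in
theorem isWeaklyRegular {rs : List R} {J : Ideal R} (h : J.IsRegularMod rs) :
    RingTheory.Sequence.IsWeaklyRegular (R ⧸ J) rs := by
  induction rs generalizing J with
  | nil => exact .nil _ _
  | cons r rs ih =>
    rw [RingTheory.Sequence.isWeaklyRegular_cons_iff]
    refine ⟨(isSMulRegular_quotient_iff_mem_of_smul_mem _ _).2 h.1, ?_⟩
    have hmap : r • (⊤ : Submodule R (R ⧸ J)) = Submodule.map J.mkQ (J ⊔ span {r}) := by
      ext y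
      obtain ⟨y, rfl⟩ := J.mkQ_surjective y
      simp only [Submodule.mem_smul_pointwise_iff_exists, Submodule.mem_map]
      constructor
      · rintro ⟨b, -, hb⟩
        obtain ⟨b, rfl⟩ := J.mkQ_surjective b
        exact ⟨r * b, mem_sup_right (mul_mem_right _ _ (mem_span_singleton_self r)),
          by rw [← hb, ← smul_eq_mul, map_smul]⟩
      · rintro ⟨z, hz, hzy⟩
        obtain ⟨c, hc⟩ := mem_sup_span_singleton_iff.1 hz
        refine ⟨J.mkQ c, trivial, ?_⟩
        rw [← hzy, ← map_smul, smul_eq_mul, eq_comm, ← sub_eq_zero, ← map_sub]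
        exact (Submodule.Quotient.mk_eq_zero J).2 hc
    have e : (R ⧸ (J ⊔ span {r})) ≃ₗ[R] QuotSMulTop r (R ⧸ J) :=
      (Submodule.quotientQuotientEquivQuotient J (J ⊔ span {r}) le_sup_left).symm ≪≫ₗ
        Submodule.quotEquivOfEq _ _ hmap.symm
    exact (e.isWeaklyRegular_congr rs).1 (ih h.2)

/-- A sequence in a proper ideal containing `J` which is regular modulo `J` is a regular sequence
on `R ⧸ J`. -/
theorem isRegular {rs : List R} {J m : Ideal R} (hm : m ≠ ⊤) (hJ : J ≤ m) (hrs : ∀ r ∈ rs, r ∈ m)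
    (h : J.IsRegularMod rs) : RingTheory.Sequence.IsRegular (R ⧸ J) rs := by
  refine ⟨h.isWeaklyRegular, fun htop ↦ hm ((eq_top_iff_one m).2 ?_)⟩
  have hle : ofList rs • (⊤ : Submodule R (R ⧸ J)) ≤ Submodule.map J.mkQ m := by
    refine Submodule.smul_le.2 fun r hr y _ ↦ ?_
    obtain ⟨x, rfl⟩ := J.mkQ_surjective y
    refine ⟨r * x, m.mul_mem_right x (span_le.2 hrs hr), ?_⟩
    rw [← smul_eq_mul, map_smul]
  obtain ⟨y, hy, hy1⟩ := hle (htop ▸ Submodule.mem_top (x := J.mkQ 1))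
  exact (m.sub_mem_iff_right hy).1 (hJ ((Submodule.Quotient.eq J).1 hy1))

/-- Regularity of a sequence passes to the middle term of
`0 → R ⧸ (J : f) → R ⧸ J → R ⧸ (J + f) → 0`. -/
theorem of_colon {rs : List R} {J A B : Ideal R} {f : R} (hA : ∀ g, g ∈ A ↔ f * g ∈ J)
    (hB : B = J ⊔ span {f}) (h₁ : A.IsRegularMod rs) (h₂ : B.IsRegularMod rs) :
    J.IsRegularMod rs := by
  induction rs generalizing J A B with
  | nil => trivial
  | cons r rs ih =>
    subst hB
    refine ⟨fun g hg ↦ ?_, ih (fun g ↦ ?_) (sup_right_comm _ _ _) h₁.2 h₂.2⟩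
    · obtain ⟨c, hc⟩ := mem_sup_span_singleton_iff.1 (h₂.1 g (mem_sup_left hg))
      have hfc : f * c ∈ J := (hA c).1 <| h₁.1 c <| (hA _).2 <| by
        convert J.sub_mem hg (J.mul_mem_left r hc) using 1
        ring
      exact (Submodule.sub_mem_iff_left J hfc).1 hc
    · simp only [mem_sup_span_singleton_iff, hA]
      constructor
      · rintro ⟨c, hc⟩
        exact ⟨f * c, by convert hc using 1; ring⟩
      · rintro ⟨c, hc⟩
        have hrc : r * c ∈ J ⊔ span {f} := mem_sup_span_singleton_iff.2
          ⟨g, by convert J.neg_mem hc using 1; ring⟩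
        obtain ⟨d, hd⟩ := mem_sup_span_singleton_iff.1 (h₂.1 c hrc)
        exact ⟨d, by convert J.add_mem hc (J.mul_mem_left r hd) using 1; ring⟩

/-- A homogeneous nonzerodivisor `a` of positive degree preceding a homogeneous regular sequence
`rs` may be moved to its end. -/
theorem of_cons_of_homogeneous {σ : Type*} [SetLike σ R] [AddSubmonoidClass σ R] (𝒜 : ℕ → σ)
    [GradedRing 𝒜] {rs : List R} {J : Ideal R} {a : R} {e : ℕ} (he : 0 < e) (ha : a ∈ 𝒜 e)
    (hJ : J.IsHomogeneous 𝒜) (hrs : ∀ r ∈ rs, SetLike.IsHomogeneousElem 𝒜 r)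
    (h : J.IsRegularMod (a :: rs)) :
    J.IsRegularMod rs ∧ ∀ g, a * g ∈ J ⊔ ofList rs → g ∈ J ⊔ ofList rs := by
  induction rs generalizing J with
  | nil => simpa [IsRegularMod] using h.1
  | cons r rs ih =>
    obtain ⟨haJ, hra, hrec⟩ := h
    have hrJ : ∀ g, r * g ∈ J → g ∈ J := by
      have key : ∀ k g, r * g ∈ J → (DirectSum.decompose 𝒜 g k : R) ∈ J := by
        intro k
        induction k using Nat.strong_induction_on with
        | _ k ihk =>
          intro g hg
          obtain ⟨c, hc⟩ := mem_sup_span_singleton_iff.1 (hra g (mem_sup_left hg))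
          have hrc : r * c ∈ J := haJ _ <| by
            convert J.sub_mem hg (J.mul_mem_left r hc) using 1
            ring
          rw [← sub_add_cancel g (a * c), DirectSum.decompose_add, DirectSum.add_apply,
            AddMemClass.coe_add]
          refine J.add_mem (hJ k hc) ?_
          by_cases hk : e ≤ k
          · obtain ⟨i, rfl⟩ := Nat.exists_eq_add_of_le hk
            rw [DirectSum.coe_decompose_mul_add_of_left_mem 𝒜 ha]
            exact J.mul_mem_left _ (ihk i (by omega) c hrc)
          · rw [DirectSum.coe_decompose_mul_of_left_mem_of_not_le 𝒜 ha hk]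
            exact J.zero_mem
      intro g hg
      classical
      rw [← DirectSum.sum_support_decompose 𝒜 g]
      exact sum_mem _ fun k _ ↦ key k g hg
    have har : ∀ g, a * g ∈ J ⊔ span {r} → g ∈ J ⊔ span {r} := by
      intro g hg
      obtain ⟨c, hc⟩ := mem_sup_span_singleton_iff.1 hg
      have hrc : r * c ∈ J ⊔ span {a} := mem_sup_span_singleton_iff.2
        ⟨g, by convert J.neg_mem hc using 1; ring⟩
      obtain ⟨d, hd⟩ := mem_sup_span_singleton_iff.1 (hra c hrc)
      exact mem_sup_span_singleton_iff.2
        ⟨d, haJ _ (by convert J.add_mem hc (J.mul_mem_left r hd) using 1; ring)⟩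
    have hJr : (J ⊔ span {r}).IsHomogeneous 𝒜 :=
      hJ.sup (homogeneous_span 𝒜 _ (by simpa using hrs r (by simp)))
    rw [sup_right_comm] at hrec
    obtain ⟨h₁, h₂⟩ := ih hJr (fun s hs ↦ hrs s (by simp [hs])) ⟨har, hrec⟩
    rw [ofList_cons, ← sup_assoc]
    exact ⟨⟨hrJ, h₁⟩, h₂⟩

end IsRegularMod

end Ideal

namespace MvPolynomial

variable {σ K : Type*} [Field K]

theorem X_mul_mem_span_X_image {V : Set σ} {v : σ} (hv : v ∉ V) {g : MvPolynomial σ K}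
    (hg : X v * g ∈ Ideal.span (X '' V : Set (MvPolynomial σ K))) :
    g ∈ Ideal.span (X '' V : Set (MvPolynomial σ K)) := by
  rw [mem_ideal_span_X_image] at hg ⊢
  intro a ha
  obtain ⟨i, hi, hne⟩ := hg (Finsupp.single v 1 + a) (by
    rwa [mem_support_iff, coeff_X_mul, ← mem_support_iff])
  refine ⟨i, hi, ?_⟩
  have : v ≠ i := fun h ↦ hv (h ▸ hi)
  simpa [Finsupp.single_apply, this] using hne

variable [Fintype σ]

variable (σ K) in
/-- The first `d` elementary symmetric polynomials of positive degree. -/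
noncomputable def esymmList (d : ℕ) : List (MvPolynomial σ K) :=
  (List.range d).map fun i ↦ esymm σ K (i + 1)

theorem isHomogeneous_esymm (k : ℕ) : (esymm σ K k).IsHomogeneous k := by
  refine IsHomogeneous.sum _ _ _ fun t ht ↦ ?_
  have := IsHomogeneous.prod t (fun i ↦ (X i : MvPolynomial σ K)) (fun _ ↦ 1)
    fun i _ ↦ isHomogeneous_X K i
  simpa [(Finset.mem_powersetCard.1 ht).2] using this

theorem esymm_mem_span_range_X {k : ℕ} (hk : k ≠ 0) :
    esymm σ K k ∈ Ideal.span (Set.range (X : σ → MvPolynomial σ K)) := by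
  refine Ideal.sum_mem _ fun t ht ↦ ?_
  obtain ⟨i, hi⟩ : t.Nonempty := by
    rw [← Finset.card_ne_zero, (Finset.mem_powersetCard.1 ht).2]
    exact hk
  exact Ideal.mem_of_dvd _ (Finset.dvd_prod_of_mem _ hi) (Ideal.subset_span ⟨i, rfl⟩)

/-- On the coordinate subspace where the variables in `V` vanish, the elementary symmetric
polynomial of top degree is the product of the remaining variables. -/
theorem esymm_sub_prod_mem_span_X_image [DecidableEq σ] (V : Finset σ) :
    esymm σ K Vᶜ.card - ∏ i ∈ Vᶜ, X i ∈
      Ideal.span (X '' (V : Set σ) : Set (MvPolynomial σ K)) := by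
  rw [esymm, ← Finset.sum_erase_eq_sub (Finset.mem_powersetCard.2 ⟨Finset.subset_univ _, rfl⟩)]
  refine Ideal.sum_mem _ fun t ht ↦ ?_
  obtain ⟨hne, ht⟩ := Finset.mem_erase.1 ht
  obtain ⟨i, hit, hiV⟩ : ∃ i ∈ t, i ∈ V := by
    by_contra! hcon
    exact hne (Finset.eq_of_subset_of_card_le (fun i hi ↦ by simpa using hcon i hi)
      (Finset.mem_powersetCard.1 ht).2.ge)
  exact Ideal.mem_of_dvd _ (Finset.dvd_prod_of_mem _ hit) (Ideal.subset_span ⟨i, hiV, rfl⟩)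

attribute [local instance] gradedAlgebra in
theorem isRegularMod_span_X_image_esymmList (V : Finset σ) {d : ℕ}
    (hd : d + V.card ≤ Fintype.card σ) :
    (Ideal.span (X '' (V : Set σ) : Set (MvPolynomial σ K))).IsRegularMod (esymmList σ K d) := by
  classical
  generalize hw : Vᶜ.card = w
  induction w generalizing V d with
  | zero =>
    have := V.card_add_card_compl
    obtain rfl : d = 0 := by omega
    trivial
  | succ w ih =>
    have hcard := V.card_add_card_compl
    set J := Ideal.span (X '' (V : Set σ) : Set (MvPolynomial σ K)) with hJdef
    have hJ : J.IsHomogeneous (homogeneousSubmodule σ K) := by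
      refine Ideal.homogeneous_span _ _ ?_
      rintro _ ⟨i, -, rfl⟩
      exact ⟨1, isHomogeneous_X K i⟩
    have key : ∀ v ∉ V, ∀ c ≤ w, J.IsRegularMod (esymmList σ K c) ∧
        ∀ g, X v * g ∈ J ⊔ Ideal.ofList (esymmList σ K c) →
          g ∈ J ⊔ Ideal.ofList (esymmList σ K c) := by
      intro v hv c hc
      refine Ideal.IsRegularMod.of_cons_of_homogeneous (homogeneousSubmodule σ K) one_pos
        (isHomogeneous_X K v) hJ ?_ ⟨fun g ↦ X_mul_mem_span_X_image (by simpa using hv), ?_⟩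
      · simp only [esymmList, List.mem_map]
        rintro _ ⟨i, -, rfl⟩
        exact ⟨_, isHomogeneous_esymm _⟩
      · have hins : J ⊔ Ideal.span {X v} =
            Ideal.span (X '' ((insert v V : Finset σ) : Set σ) : Set (MvPolynomial σ K)) := by
          rw [hJdef, ← Ideal.span_union, Finset.coe_insert, Set.image_insert_eq, Set.union_comm,
            Set.singleton_union]
        rw [hins]
        have hcard' := (insert v V).card_add_card_compl
        have := Finset.card_insert_of_notMem hv
        exact ih _ (by omega) (by omega)
    obtain ⟨v, hv⟩ : (Vᶜ).Nonempty := by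
      rw [← Finset.card_ne_zero]
      omega
    rw [Finset.mem_compl] at hv
    obtain hdw | rfl : d ≤ w ∨ d = w + 1 := by omega
    · exact (key v hv d hdw).1
    · rw [esymmList, List.range_succ, List.map_append, ← esymmList]
      refine (key v hv w le_rfl).1.append ⟨fun g hg ↦ ?_, trivial⟩
      have hprod : (∏ i ∈ Vᶜ, X i) * g ∈ J ⊔ Ideal.ofList (esymmList σ K w) := by
        rw [← sub_sub_cancel (esymm σ K (w + 1)) (∏ i ∈ Vᶜ, X i), sub_mul]
        refine Ideal.sub_mem _ hg (Ideal.mem_sup_left (Ideal.mul_mem_right _ _ ?_))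
        rw [← hw]
        exact esymm_sub_prod_mem_span_X_image V
      have hT : ∀ T ⊆ Vᶜ, (∏ i ∈ T, X i) * g ∈ J ⊔ Ideal.ofList (esymmList σ K w) →
          g ∈ J ⊔ Ideal.ofList (esymmList σ K w) := by
        intro T
        induction T using Finset.induction_on with
        | empty => simp
        | insert i T hi ihT =>
          intro hsub hmem
          rw [Finset.prod_insert hi, mul_assoc] at hmem
          exact ihT (fun j hj ↦ hsub (Finset.mem_insert_of_mem hj)) <|
            (key i (Finset.mem_compl.1 (hsub (Finset.mem_insert_self _ _))) w le_rfl).2 _ hmem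
      exact hT _ subset_rfl hprod

end MvPolynomial

section AssociatedPrimes

variable {R M : Type*} [CommRing R] [IsNoetherianRing R] [AddCommGroup M] [Module R M]
  [Module.Finite R M]

open scoped Pointwise in
theorem IsAssociatedPrime.exists_lt_quotSMulTop {P m : Ideal R} [m.IsPrime]
    (hP : IsAssociatedPrime P M) (hPm : P ≤ m) {a : R} (ham : a ∈ m) (ha : IsSMulRegular M a) :
    ∃ Q : Ideal R, IsAssociatedPrime Q (QuotSMulTop a M) ∧ Q ≤ m ∧ P ≤ Q ∧ a ∈ Q ∧ a ∉ P := by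
  obtain ⟨hprime, x, hx⟩ := isAssociatedPrime_iff.1 hP
  have hxP : ∀ r, r ∈ P ↔ r • x = 0 := fun r ↦ by rw [hx, Submodule.mem_colon_singleton]; simp
  let N : Submodule R M := Submodule.torsionBySet R M P
  have hN : ∀ y, y ∈ N ↔ ∀ p ∈ P, p • y = 0 := fun y ↦ by
    simp [N, Submodule.mem_torsionBySet_iff]
  let N' : Submodule R (QuotSMulTop a M) := N.map (a • (⊤ : Submodule R M)).mkQ
  have hxN : x ∈ N := (hN x).2 fun p hp ↦ (hxP p).1 hp
  have hann : Module.annihilator R N' ≤ m := by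
    intro r hr
    have hrN : ∀ y ∈ N, ∃ z ∈ N, a • z = r • y := by
      intro y hy
      have h0 : (a • (⊤ : Submodule R M)).mkQ (r • y) = 0 := by
        rw [map_smul]
        exact congrArg Subtype.val
          (Module.mem_annihilator.1 hr ⟨_, Submodule.mem_map_of_mem hy⟩)
      rw [Submodule.mkQ_apply, Submodule.Quotient.mk_eq_zero,
        Submodule.mem_smul_pointwise_iff_exists] at h0
      obtain ⟨z, -, hz⟩ := h0
      refine ⟨z, (hN z).2 fun p hp ↦ ha.right_eq_zero_of_smul ?_, hz⟩
      rw [smul_comm, hz, smul_comm, (hN y).1 hy p hp, smul_zero]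
    obtain ⟨p, hmonic, -, hcoeff, hp⟩ :=
      LinearMap.exists_monic_and_natDegree_eq_and_coeff_mem_pow_and_aeval_eq_zero R
        (algebraMap R (Module.End R N) r) (Ideal.span {a}) (by
          rintro _ ⟨y, rfl⟩
          obtain ⟨z, hz, hzy⟩ := hrN y y.2
          rw [Module.algebraMap_end_apply, show r • y = a • (⟨z, hz⟩ : N) from Subtype.ext hzy.symm]
          exact Submodule.smul_mem_smul (Ideal.mem_span_singleton_self a) trivial)
    have hpr : p.eval r ∈ m := by
      refine hPm ((hxP _).2 ?_)
      rw [Polynomial.aeval_algebraMap_apply_eq_algebraMap_eval] at hp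
      simpa using congrArg Subtype.val (LinearMap.congr_fun hp ⟨x, hxN⟩)
    have hlead : p.eval r - r ^ p.natDegree ∈ m := by
      rw [Polynomial.eval_eq_sum_range, Finset.sum_range_succ, hmonic.coeff_natDegree, one_mul,
        add_sub_cancel_right]
      refine Ideal.sum_mem _ fun i hi ↦ Ideal.mul_mem_right _ _ ?_
      have hle : Ideal.span {a} ^ (p.natDegree - i) ≤ m :=
        (Ideal.pow_le_self (by have := Finset.mem_range.1 hi; omega)).trans
          ((Ideal.span_singleton_le_iff_mem m).2 ham)
      exact hle (hcoeff i)
    exact ‹m.IsPrime›.mem_of_pow_mem _ ((Submodule.sub_mem_iff_right m hpr).1 hlead)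
  obtain ⟨Q, hQmin, hQm⟩ := Ideal.exists_minimalPrimes_le hann
  refine ⟨Q, ?_, hQm, ?_, ?_, ?_⟩
  · exact IsAssociatedPrime.map_of_injective N'.subtype
      (Module.associatedPrimes.minimalPrimes_annihilator_subset_associatedPrimes R N' hQmin)
      N'.injective_subtype
  · refine le_trans (fun p hp ↦ Module.mem_annihilator.2 ?_) hQmin.1.2
    rintro ⟨_, y, hy, rfl⟩
    ext
    simp only [Submodule.coe_smul, ← map_smul, (hN y).1 hy p hp, map_zero, Submodule.coe_zero]
  · refine hQmin.1.2 (Module.mem_annihilator.2 ?_)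
    rintro ⟨_, y, hy, rfl⟩
    ext
    rw [Submodule.coe_smul, ← map_smul, Submodule.mkQ_apply, Submodule.coe_zero,
      Submodule.Quotient.mk_eq_zero]
    exact Submodule.smul_mem_pointwise_smul _ _ _ Submodule.mem_top
  · intro haP
    have hx0 : x = 0 := ha.right_eq_zero_of_smul ((hxP a).1 haP)
    exact hprime.ne_top ((Ideal.eq_top_iff_one _).2 ((hxP 1).2 (by simp [hx0])))

/-- The length of a regular sequence on `M` is at most `dim R ⧸ P` for every associated prime `P`
of `M`. -/
theorem IsAssociatedPrime.length_le_ringKrullDim {P m : Ideal R} [m.IsPrime]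
    (hP : IsAssociatedPrime P M) (hPm : P ≤ m) {rs : List R} (hrs : ∀ r ∈ rs, r ∈ m)
    (h : RingTheory.Sequence.IsWeaklyRegular M rs) :
    (rs.length : WithBot ℕ∞) ≤ ringKrullDim (R ⧸ P) := by
  induction rs generalizing M P with
  | nil =>
    have := hP.isPrime
    simpa using ringKrullDim_nonneg_of_nontrivial (R := R ⧸ P)
  | cons a rs ih =>
    rw [RingTheory.Sequence.isWeaklyRegular_cons_iff] at h
    obtain ⟨Q, hQ, hQm, hPQ, haQ, haP⟩ :=
      hP.exists_lt_quotSMulTop hPm (hrs a (by simp)) h.1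
    have := hP.isPrime
    have hdim := ringKrullDim_succ_le_of_surjective (Ideal.Quotient.factor hPQ)
      (Ideal.Quotient.factor_surjective hPQ) (r := Ideal.Quotient.mk P a)
      (mem_nonZeroDivisors_of_ne_zero (by rwa [Ne, Ideal.Quotient.eq_zero_iff_mem]))
      (by simpa [Ideal.Quotient.eq_zero_iff_mem] using haQ)
    refine le_trans ?_ hdim
    push_cast [List.length_cons]
    gcongr
    exact ih hQ hQm (fun r hr ↦ hrs r (by simp [hr])) h.2

end AssociatedPrimes

namespace MvPolynomial

variable {σ K : Type*} [Field K]

variable (K) in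
/-- The ideal spanned by the monomials with exponents in `U`. -/
noncomputable def monomialIdeal (U : Set (σ →₀ ℕ)) : Ideal (MvPolynomial σ K) :=
  Ideal.span ((fun a ↦ monomial a 1) '' U)

theorem mem_monomialIdeal {U : Set (σ →₀ ℕ)} (hU : IsUpperSet U) {g : MvPolynomial σ K} :
    g ∈ monomialIdeal K U ↔ ∀ a ∈ g.support, a ∈ U := by
  rw [monomialIdeal, mem_ideal_span_monomial_image]
  exact forall₂_congr fun a _ ↦ ⟨fun ⟨b, hb, hba⟩ ↦ hU hba hb, fun ha ↦ ⟨a, ha, le_rfl⟩⟩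

theorem monomialIdeal_exists_ne_zero (V : Set σ) :
    monomialIdeal K {a | ∃ v ∈ V, a v ≠ 0} = Ideal.span (X '' V) := by
  ext g
  rw [mem_monomialIdeal, mem_ideal_span_X_image]
  · rfl
  · rintro a b hab ⟨v, hv, hav⟩
    exact ⟨v, hv, (hav.bot_lt.trans_le (hab v)).ne'⟩

theorem monomial_mul_mem_monomialIdeal {U : Set (σ →₀ ℕ)} (hU : IsUpperSet U) {f : σ →₀ ℕ}
    {g : MvPolynomial σ K} :
    monomial f 1 * g ∈ monomialIdeal K U ↔ ∀ a ∈ g.support, f + a ∈ U := by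
  classical
  rw [mem_monomialIdeal hU]
  constructor
  · intro h a ha
    refine h _ ?_
    rwa [mem_support_iff, coeff_monomial_mul, one_mul, ← mem_support_iff]
  · intro h b hb
    rw [mem_support_iff, coeff_monomial_mul'] at hb
    split_ifs at hb with hfb
    · rw [← add_tsub_cancel_of_le hfb]
      refine h _ ?_
      rwa [one_mul, ← mem_support_iff] at hb
    · exact absurd rfl hb

theorem isRegularMod_monomialIdeal_of_colon {U A B : Set (σ →₀ ℕ)} (hU : IsUpperSet U)
    {f : σ →₀ ℕ} (hA : ∀ a, a ∈ A ↔ f + a ∈ U) (hB : ∀ a, a ∈ B ↔ a ∈ U ∨ f ≤ a)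
    {rs : List (MvPolynomial σ K)} (h₁ : (monomialIdeal K A).IsRegularMod rs)
    (h₂ : (monomialIdeal K B).IsRegularMod rs) : (monomialIdeal K U).IsRegularMod rs := by
  refine Ideal.IsRegularMod.of_colon (f := monomial f 1) (fun g ↦ ?_) ?_ h₁ h₂
  · rw [mem_monomialIdeal, monomial_mul_mem_monomialIdeal hU]
    · simp only [hA]
    · intro a b hab ha
      rw [hA] at ha ⊢
      exact hU (by gcongr) ha
  · rw [monomialIdeal, monomialIdeal, ← Set.image_singleton (f := fun a ↦ monomial a (1 : K)),
      ← Ideal.span_union, ← Set.image_union]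
    ext g
    rw [mem_ideal_span_monomial_image, mem_ideal_span_monomial_image]
    refine forall₂_congr fun a _ ↦ ⟨?_, ?_⟩
    · rintro ⟨b, hb, hba⟩
      obtain hb | hb := (hB b).1 hb
      · exact ⟨b, .inl hb, hba⟩
      · exact ⟨f, .inr rfl, hb.trans hba⟩
    · rintro ⟨b, hb | rfl, hba⟩
      · exact ⟨b, (hB b).2 (.inl hb), hba⟩
      · exact ⟨b, (hB b).2 (.inr le_rfl), hba⟩

end MvPolynomial

section Path

variable {n : ℕ}

/-- The variable in position `p` divides the monomial with exponent `a`. -/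
def HasVar (a : Fin n →₀ ℕ) (p : ℕ) : Prop := ∃ h : p < n, a ⟨p, h⟩ ≠ 0

theorem HasVar.mono {a b : Fin n →₀ ℕ} (hab : a ≤ b) {p : ℕ} : HasVar a p → HasVar b p :=
  fun ⟨h, ha⟩ ↦ ⟨h, (ha.bot_lt.trans_le (hab _)).ne'⟩

variable (n) in
/-- The exponent of the product of the variables in positions `s ≤ p < u`. -/
noncomputable def intervalExp (s u : ℕ) : Fin n →₀ ℕ :=
  Finsupp.equivFunOnFinite.symm fun j ↦ if s ≤ j ∧ (j : ℕ) < u then 1 else 0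

theorem intervalExp_apply (s u : ℕ) (j : Fin n) :
    intervalExp n s u j = if s ≤ j ∧ (j : ℕ) < u then 1 else 0 := rfl

theorem intervalExp_le_iff {s u : ℕ} (hu : u ≤ n) {a : Fin n →₀ ℕ} :
    intervalExp n s u ≤ a ↔ ∀ p, s ≤ p → p < u → HasVar a p := by
  simp only [Finsupp.le_def, intervalExp_apply, HasVar]
  constructor
  · intro h p hs hp
    have := h ⟨p, by omega⟩
    rw [if_pos ⟨hs, hp⟩] at this
    exact ⟨by omega, by omega⟩
  · intro h j
    split_ifs with hj
    · obtain ⟨_, ha⟩ := h j hj.1 hj.2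
      exact Nat.one_le_iff_ne_zero.2 ha
    · exact Nat.zero_le _

theorem hasVar_intervalExp_add_iff {s u : ℕ} (hu : u ≤ n) {a : Fin n →₀ ℕ} {p : ℕ} :
    HasVar (intervalExp n s u + a) p ↔ (s ≤ p ∧ p < u) ∨ HasVar a p := by
  by_cases hp : p < n
  · simp only [HasVar, hp, exists_true_left, Finsupp.add_apply, intervalExp_apply]
    split_ifs with h <;> simp [h]
  · simp only [HasVar, hp, IsEmpty.exists_iff, or_false, false_iff]
    omega

variable (n) in
/-- The exponents of the monomials in the ideal generated by the variables in `V`, the products of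
`m` consecutive variables in positions below `t`, and the product of the variables in positions
`s ≤ p < t`. -/
def pathExps (m : ℕ) (V : Finset (Fin n)) (s t : ℕ) : Set (Fin n →₀ ℕ) :=
  {a | (∃ v ∈ (V : Set (Fin n)), a v ≠ 0) ∨
    (∃ i, i + m ≤ t ∧ ∀ p, i ≤ p → p < i + m → HasVar a p) ∨
    ∀ p, s ≤ p → p < t → HasVar a p}

theorem isUpperSet_pathExps (m : ℕ) (V : Finset (Fin n)) (s t : ℕ) :
    IsUpperSet (pathExps n m V s t) := by
  rintro a b hab (⟨v, hv, hav⟩ | ⟨i, hi, h⟩ | h)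
  · exact .inl ⟨v, hv, (hav.bot_lt.trans_le (hab v)).ne'⟩
  · exact .inr (.inl ⟨i, hi, fun p h₁ h₂ ↦ (h p h₁ h₂).mono hab⟩)
  · exact .inr (.inr fun p h₁ h₂ ↦ (h p h₁ h₂).mono hab)

/-- The least possible `j`-th element of a minimal vertex cover of the path hypergraph. -/
def coverBound (m : ℕ) : ℕ → ℕ
  | 0 => 0
  | 1 => 1
  | j + 2 => coverBound m j + (m + 1)

theorem coverBound_lt_succ {m : ℕ} (hm : 1 ≤ m) (j : ℕ) :
    coverBound m j < coverBound m (j + 1) := by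
  induction j using Nat.twoStepInduction with
  | zero => simp [coverBound]
  | one => simp only [coverBound]; omega
  | more j ih _ => simpa only [coverBound, add_lt_add_iff_right] using ih

theorem exists_mem_insert_ne_zero_iff {V : Finset (Fin n)} {t : ℕ} (ht : t < n)
    {a : Fin n →₀ ℕ} :
    (∃ v ∈ ((insert ⟨t, ht⟩ V : Finset (Fin n)) : Set (Fin n)), a v ≠ 0) ↔
      HasVar a t ∨ ∃ v ∈ (V : Set (Fin n)), a v ≠ 0 := by
  simp [HasVar, ht]

theorem pathExps_self_succ {m : ℕ} {V : Finset (Fin n)} {t : ℕ} (ht : t < n) (hm : 1 ≤ m)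
    (hmt : m ≤ t) :
    pathExps n m V t (t + 1) = pathExps n m (insert ⟨t, ht⟩ V) (t - m) t := by
  ext a
  simp only [pathExps, Set.mem_ofPred_eq, exists_mem_insert_ne_zero_iff]
  constructor
  · rintro (h | ⟨i, hi, h⟩ | h)
    · exact .inl (.inr h)
    · by_cases hit : i + m = t + 1
      · exact .inl (.inl (h t (by omega) (by omega)))
      · exact .inr (.inl ⟨i, by omega, h⟩)
    · exact .inl (.inl (h t le_rfl (by omega)))
  · rintro ((h | h) | ⟨i, hi, h⟩ | h)
    · exact .inr (.inr fun p h₁ h₂ ↦ (show p = t by omega) ▸ h)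
    · exact .inl h
    · exact .inr (.inl ⟨i, by omega, h⟩)
    · exact .inr (.inl ⟨t - m, by omega, fun p h₁ h₂ ↦ h p h₁ (by omega)⟩)

theorem pathExps_self_succ_of_lt {m : ℕ} {V : Finset (Fin n)} {t : ℕ} (ht : t < n)
    (hmt : t < m) :
    pathExps n m V t (t + 1) =
      {a | ∃ v ∈ ((insert ⟨t, ht⟩ V : Finset (Fin n)) : Set (Fin n)), a v ≠ 0} := by
  ext a
  simp only [pathExps, Set.mem_ofPred_eq, exists_mem_insert_ne_zero_iff]
  constructor
  · rintro (h | ⟨i, hi, h⟩ | h)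
    · exact .inr h
    · exact .inl (h t (by omega) (by omega))
    · exact .inl (h t le_rfl (by omega))
  · rintro (h | h)
    · exact .inr (.inr fun p h₁ h₂ ↦ (show p = t by omega) ▸ h)
    · exact .inl h

theorem mem_pathExps_iff_succ {m : ℕ} {V : Finset (Fin n)} {s t : ℕ} (ht : t < n)
    (hts : t < s + m) {a : Fin n →₀ ℕ} :
    a ∈ pathExps n m V s t ↔ a ∈ pathExps n m V s (t + 1) ∨ intervalExp n s t ≤ a := by
  rw [intervalExp_le_iff ht.le]
  constructor
  · rintro (h | ⟨i, hi, h⟩ | h)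
    · exact .inl (.inl h)
    · exact .inl (.inr (.inl ⟨i, by omega, h⟩))
    · exact .inr h
  · rintro ((h | ⟨i, hi, h⟩ | h) | h)
    · exact .inl h
    · by_cases hit : i + m = t + 1
      · exact .inr (.inr fun p h₁ h₂ ↦ h p (by omega) (by omega))
      · exact .inr (.inl ⟨i, by omega, h⟩)
    · exact .inr (.inr fun p h₁ h₂ ↦ h p h₁ (by omega))
    · exact .inr (.inr h)

theorem exists_intervalExp_add_ne_zero_iff {V : Finset (Fin n)} {s t : ℕ}
    (hV : ∀ v ∈ V, t < (v : ℕ)) {a : Fin n →₀ ℕ} :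
    (∃ v ∈ (V : Set (Fin n)), (intervalExp n s t + a) v ≠ 0) ↔
      ∃ v ∈ (V : Set (Fin n)), a v ≠ 0 := by
  refine exists_congr fun v ↦ and_congr_right fun hv ↦ ?_
  have := hV v hv
  rw [Finsupp.add_apply, intervalExp_apply, if_neg (by omega), zero_add]

theorem intervalExp_add_mem_pathExps_iff {m : ℕ} {V : Finset (Fin n)} {s t : ℕ} (ht : t < n)
    (hst : s < t) (hts : t < s + m) (hmt : m ≤ t) (hV : ∀ v ∈ V, t < (v : ℕ))
    {a : Fin n →₀ ℕ} :
    a ∈ pathExps n m (insert ⟨t, ht⟩ V) (t - m) s ↔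
      intervalExp n s t + a ∈ pathExps n m V s (t + 1) := by
  simp only [pathExps, Set.mem_ofPred_eq, exists_mem_insert_ne_zero_iff,
    exists_intervalExp_add_ne_zero_iff hV, hasVar_intervalExp_add_iff ht.le]
  constructor
  · rintro ((h | h) | ⟨i, hi, h⟩ | h)
    · refine .inr (.inr fun p h₁ h₂ ↦ ?_)
      obtain rfl | h := (show p = t ∨ p < t by omega)
      · exact .inr h
      · exact .inl ⟨h₁, h⟩
    · exact .inl h
    · exact .inr (.inl ⟨i, by omega, fun p h₁ h₂ ↦ .inr (h p h₁ h₂)⟩)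
    · refine .inr (.inl ⟨t - m, by omega, fun p h₁ h₂ ↦ ?_⟩)
      obtain hp | hp := lt_or_ge p s
      · exact .inr (h p h₁ hp)
      · exact .inl ⟨hp, by omega⟩
  · rintro (h | ⟨i, hi, h⟩ | h)
    · exact .inl (.inr h)
    · by_cases hit : i + m = t + 1
      · exact .inl (.inl ((h t (by omega) (by omega)).resolve_left (by omega)))
      by_cases his : i + m ≤ s
      · exact .inr (.inl ⟨i, his, fun p h₁ h₂ ↦ (h p h₁ h₂).resolve_left (by omega)⟩)
      · exact .inr (.inr fun p h₁ h₂ ↦ (h p (by omega) (by omega)).resolve_left (by omega))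
    · exact .inl (.inl ((h t (by omega) (by omega)).resolve_left (by omega)))

theorem intervalExp_add_mem_pathExps_iff_of_lt {m : ℕ} {V : Finset (Fin n)} {s t : ℕ}
    (ht : t < n) (hst : s < t) (hmt : t < m) (hV : ∀ v ∈ V, t < (v : ℕ)) {a : Fin n →₀ ℕ} :
    (∃ v ∈ ((insert ⟨t, ht⟩ V : Finset (Fin n)) : Set (Fin n)), a v ≠ 0) ↔
      intervalExp n s t + a ∈ pathExps n m V s (t + 1) := by
  simp only [pathExps, Set.mem_ofPred_eq, exists_mem_insert_ne_zero_iff,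
    exists_intervalExp_add_ne_zero_iff hV, hasVar_intervalExp_add_iff ht.le]
  constructor
  · rintro (h | h)
    · refine .inr (.inr fun p h₁ h₂ ↦ ?_)
      obtain rfl | h := (show p = t ∨ p < t by omega)
      · exact .inr h
      · exact .inl ⟨h₁, h⟩
    · exact .inl h
  · rintro (h | ⟨i, hi, h⟩ | h)
    · exact .inr h
    · exact .inl ((h t (by omega) (by omega)).resolve_left (by omega))
    · exact .inl ((h t (by omega) (by omega)).resolve_left (by omega))

theorem isRegularMod_pathExps (K : Type*) [Field K] {m s t l d : ℕ} (hm : 1 ≤ m)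
    {V : Finset (Fin n)} (hst : s < t) (hts : t ≤ s + m) (htn : t ≤ n)
    (hV : ∀ v ∈ V, t ≤ (v : ℕ)) (hl : s < coverBound m l ∨ t < coverBound m (l + 1))
    (hd : d + V.card + l ≤ n) :
    (monomialIdeal K (pathExps n m V s t)).IsRegularMod (esymmList (Fin n) K d) := by
  induction t using Nat.strong_induction_on generalizing s l V with
  | _ t ih =>
    obtain _ | t := t
    · omega
    obtain _ | l := l
    · simp only [coverBound] at hl
      omega
    have hbound := coverBound_lt_succ hm l
    have hbound' := coverBound_lt_succ hm (l + 1)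
    rw [show coverBound m (l + 1 + 1) = coverBound m l + (m + 1) from rfl] at hl hbound'
    have htV : (⟨t, htn⟩ : Fin n) ∉ V := fun h ↦ by simpa using hV _ h
    have hV' : ∀ v ∈ insert (⟨t, htn⟩ : Fin n) V, t ≤ (v : ℕ) := by
      simp only [Finset.mem_insert, forall_eq_or_imp, le_refl, true_and]
      exact fun v hv ↦ (Nat.le_succ t).trans (hV v hv)
    have hcard := Finset.card_insert_of_notMem htV
    obtain rfl | hst' := Nat.eq_or_lt_of_le (Nat.le_of_lt_succ hst)
    · obtain hsm | hsm := lt_or_ge s m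
      · rw [pathExps_self_succ_of_lt htn hsm, monomialIdeal_exists_ne_zero]
        exact isRegularMod_span_X_image_esymmList _ (by rw [Fintype.card_fin]; omega)
      · rw [pathExps_self_succ htn hm hsm]
        exact ih s (by omega) (by omega) (by omega) (by omega) hV' (l := l) (by omega) (by omega)
    · have hV'' : ∀ v ∈ V, t < (v : ℕ) := fun v hv ↦ hV v hv
      have hB : (monomialIdeal K (pathExps n m V s t)).IsRegularMod (esymmList (Fin n) K d) :=
        ih t (by omega) (by omega) (by omega) (by omega) (fun v hv ↦ (hV'' v hv).le)
          (l := l + 1)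
          (by rw [show coverBound m (l + 1 + 1) = coverBound m l + (m + 1) from rfl]; omega) hd
      obtain htm | htm := lt_or_ge t m
      · refine isRegularMod_monomialIdeal_of_colon (isUpperSet_pathExps m V s (t + 1))
          (A := {a | ∃ v ∈ ((insert ⟨t, htn⟩ V : Finset (Fin n)) : Set (Fin n)), a v ≠ 0})
          (fun a ↦ intervalExp_add_mem_pathExps_iff_of_lt htn hst' htm hV'')
          (fun a ↦ mem_pathExps_iff_succ htn hts) ?_ hB
        rw [monomialIdeal_exists_ne_zero]
        exact isRegularMod_span_X_image_esymmList _ (by rw [Fintype.card_fin]; omega)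
      · refine isRegularMod_monomialIdeal_of_colon (isUpperSet_pathExps m V s (t + 1))
          (fun a ↦ intervalExp_add_mem_pathExps_iff htn hst' hts htm hV'')
          (fun a ↦ mem_pathExps_iff_succ htn hts) ?_ hB
        exact ih s (by omega) (by omega) (by omega) (by omega)
          (fun v hv ↦ hst'.le.trans (hV' v hv)) (l := l) (by omega) (by omega)

end Path

namespace MvPolynomial

variable {σ K : Type*} [Field K]

variable (K) in
open Classical in
/-- The projection of the polynomial ring killing the variables in `C`. -/
noncomputable def killVars (C : Set σ) : MvPolynomial σ K →ₐ[K] MvPolynomial {i // i ∉ C} K :=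
  aeval fun i ↦ if h : i ∈ C then 0 else X ⟨i, h⟩

theorem mk_rename_killVars (C : Set σ) (g : MvPolynomial σ K) :
    Ideal.Quotient.mkₐ K (Ideal.span (X '' C)) (rename Subtype.val (killVars K C g)) =
      Ideal.Quotient.mkₐ K (Ideal.span (X '' C)) g := by
  suffices h : ((Ideal.Quotient.mkₐ K (Ideal.span (X '' C))).comp (rename Subtype.val)).comp
      (killVars K C) = Ideal.Quotient.mkₐ K (Ideal.span (X '' C)) from DFunLike.congr_fun h g
  ext i
  by_cases h : i ∈ C
  · simpa [killVars, h] using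
      (Ideal.Quotient.eq_zero_iff_mem.2 (Ideal.subset_span (Set.mem_image_of_mem X h))).symm
  · simp [killVars, h]

theorem ker_killVars (C : Set σ) : RingHom.ker (killVars K C) = Ideal.span (X '' C) := by
  refine le_antisymm (fun g hg ↦ ?_) (Ideal.span_le.2 ?_)
  · have := mk_rename_killVars C g
    rw [RingHom.mem_ker.1 hg, map_zero, map_zero] at this
    exact Ideal.Quotient.eq_zero_iff_mem.1 this.symm
  · rintro _ ⟨i, hi, rfl⟩
    simp [killVars, hi]

theorem isPrime_span_X_image (C : Set σ) :
    (Ideal.span (X '' C : Set (MvPolynomial σ K))).IsPrime := by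
  rw [← ker_killVars]
  exact RingHom.ker_isPrime _

theorem ringKrullDim_quotient_span_X_image_le [Fintype σ] (C : Finset σ) :
    ringKrullDim (MvPolynomial σ K ⧸ Ideal.span (X '' (C : Set σ) : Set (MvPolynomial σ K))) ≤
      (Fintype.card σ - C.card : ℕ) := by
  classical
  have hsurj : Function.Surjective ((Ideal.Quotient.mkₐ K
      (Ideal.span (X '' (C : Set σ) : Set (MvPolynomial σ K)))).comp
        (rename (Subtype.val : {i // i ∉ (C : Set σ)} → σ))) := fun y ↦ by
    obtain ⟨g, rfl⟩ := Ideal.Quotient.mkₐ_surjective K _ y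
    exact ⟨_, mk_rename_killVars _ g⟩
  refine (ringKrullDim_le_of_surjective _ hsurj).trans ?_
  rw [MvPolynomial.ringKrullDim_of_isNoetherianRing, ringKrullDim_eq_zero_of_field, zero_add,
    Nat.card_eq_fintype_card]
  simp [Fintype.card_subtype_compl]

theorem isAssociatedPrime_quotient_monomialIdeal [Finite σ] {U : Set (σ →₀ ℕ)}
    (hU : IsUpperSet U) {C : Set σ} {f : σ →₀ ℕ} (hf : ∀ a, f + a ∈ U ↔ ∃ v ∈ C, a v ≠ 0) :
    IsAssociatedPrime (Ideal.span (X '' C : Set (MvPolynomial σ K)))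
      (MvPolynomial σ K ⧸ monomialIdeal K U) := by
  refine isAssociatedPrime_iff.2 ⟨isPrime_span_X_image C,
    Ideal.Quotient.mk _ (monomial f 1), ?_⟩
  ext g
  rw [Submodule.mem_colon_singleton, Submodule.mem_bot,
    show g • Ideal.Quotient.mk (monomialIdeal K U) (monomial f 1) =
      Ideal.Quotient.mk _ (g * monomial f 1) from rfl, Ideal.Quotient.eq_zero_iff_mem, mul_comm,
    monomial_mul_mem_monomialIdeal hU, mem_ideal_span_X_image]
  simp only [hf]

end MvPolynomial

section Path

variable {n m : ℕ}

theorem coverBound_eq (m j : ℕ) : coverBound m j = j / 2 * (m + 1) + j % 2 := by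
  induction j using Nat.twoStepInduction with
  | zero => simp [coverBound]
  | one => simp [coverBound]
  | more j ih _ =>
    rw [coverBound, ih, show (j + 2) / 2 = j / 2 + 1 by omega, Nat.add_mod_right]
    ring

variable (n m) in
/-- The largest height of an associated prime of the path ideal. -/
def pathCoverCard : ℕ := (n + 1) / (m + 1) + (n + m + 1) / (m + 1) - 1

theorem pathCoverCard_cases (hn : m ≤ n) :
    ∃ q, (n + 1 = (q + 1) * (m + 1) ∧ pathCoverCard n m = 2 * q + 1) ∨
      ((q + 1) * (m + 1) ≤ n ∧ n < (q + 1) * (m + 1) + m ∧ pathCoverCard n m = 2 * q + 2) := by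
  have hq : 1 ≤ (n + 1) / (m + 1) := (Nat.one_le_div_iff (by omega)).2 (by omega)
  obtain ⟨q, hq⟩ := Nat.exists_eq_add_of_le' hq
  refine ⟨q, ?_⟩
  have h₁ := Nat.div_mul_le_self (n + 1) (m + 1)
  have h₂ := Nat.lt_div_mul_add (a := n + 1) (b := m + 1) (by omega)
  rw [hq] at h₁ h₂
  obtain h | h := h₁.eq_or_lt
  · left
    refine ⟨h.symm, ?_⟩
    rw [pathCoverCard, hq, show (n + m + 1) / (m + 1) = q + 1 from
      Nat.div_eq_of_lt_le (by omega) (by rw [add_mul _ 1]; omega)]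
    omega
  · right
    refine ⟨by omega, by omega, ?_⟩
    rw [pathCoverCard, hq, show (n + m + 1) / (m + 1) = q + 2 from
      Nat.div_eq_of_lt_le (by rw [show q + 2 = q + 1 + 1 from rfl, add_mul _ 1]; omega)
        (by rw [show q + 2 + 1 = q + 1 + 1 + 1 from rfl, add_mul _ 1, add_mul (q + 1) 1]; omega)]
    omega

theorem sub_lt_coverBound_pathCoverCard (hn : m ≤ n) :
    n - m < coverBound m (pathCoverCard n m) := by
  obtain ⟨q, ⟨h, hD⟩ | ⟨h₁, h₂, hD⟩⟩ := pathCoverCard_cases hn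
  · rw [hD, coverBound_eq, show (2 * q + 1) / 2 = q by omega]
    rw [add_mul] at h
    omega
  · rw [hD, coverBound_eq, show (2 * q + 2) / 2 = q + 1 by omega]
    omega

variable (n m) in
/-- A minimal vertex cover of largest size of the path hypergraph. -/
def pathCover : Finset (Fin n) :=
  {j | ((j : ℕ) % (m + 1) = 0 ∧ j + m ≤ n) ∨ ((j : ℕ) + 1) % (m + 1) = 0}

theorem pathCoverCard_le_card_pathCover (hm : 1 ≤ m) (hn : m ≤ n) :
    pathCoverCard n m ≤ (pathCover n m).card := by
  rw [← (pathCover n m).card_map Fin.valEmbedding, ← Finset.card_range (pathCoverCard n m)]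
  have hmono := strictMono_nat_of_lt_succ (coverBound_lt_succ hm)
  refine Finset.card_le_card_of_injOn (fun k ↦ coverBound m (k + 1) - 1) (fun k hk ↦ ?_) ?_
  · have hk : k < pathCoverCard n m := by simpa using hk
    simp only [Finset.mem_coe, Finset.mem_map, Fin.valEmbedding_apply, pathCover,
      Finset.mem_filter_univ]
    rw [coverBound_eq]
    obtain ⟨c, rfl | rfl⟩ := Nat.even_or_odd' k
    · have hc : c * (m + 1) + m ≤ n := by
        obtain ⟨q, ⟨h, hD⟩ | ⟨h₁, h₂, hD⟩⟩ := pathCoverCard_cases hn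
        · have := Nat.mul_le_mul_right (m + 1) (show c + 1 ≤ q + 1 by omega)
          rw [add_mul c] at this
          omega
        · have := Nat.mul_le_mul_right (m + 1) (show c + 1 ≤ q + 1 by omega)
          rw [add_mul c] at this
          omega
      rw [show (2 * c + 1) / 2 = c by omega, show (2 * c + 1) % 2 = 1 by omega,
        Nat.add_sub_cancel]
      exact ⟨⟨c * (m + 1), by omega⟩, .inl ⟨Nat.mul_mod_left _ _, hc⟩, rfl⟩
    · have hc : (c + 1) * (m + 1) ≤ n := by
        obtain ⟨q, ⟨h, hD⟩ | ⟨h₁, h₂, hD⟩⟩ := pathCoverCard_cases hn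
        · have := Nat.mul_le_mul_right (m + 1) (show c + 1 ≤ q by omega)
          rw [add_mul q] at h
          omega
        · have := Nat.mul_le_mul_right (m + 1) (show c + 1 ≤ q + 1 by omega)
          omega
      have hpos : 0 < (c + 1) * (m + 1) := by positivity
      rw [show (2 * c + 1 + 1) / 2 = c + 1 by omega, show (2 * c + 1 + 1) % 2 = 0 by omega,
        add_zero]
      refine ⟨⟨(c + 1) * (m + 1) - 1, by omega⟩, .inr ?_, rfl⟩
      rw [Fin.val_mk, Nat.sub_add_cancel hpos]
      exact Nat.mul_mod_left _ _
  · intro k _ k' _ h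
    have h₁ := hmono k.succ_pos
    have h₂ := hmono k'.succ_pos
    refine Nat.succ_injective (hmono.injective ?_)
    simp only [Nat.succ_eq_add_one] at h₁ h₂ ⊢
    dsimp only at h
    omega

theorem exists_mem_pathCover {i : ℕ} (hm : 1 ≤ m) (hi : i + m ≤ n) :
    ∃ v ∈ pathCover n m, i ≤ (v : ℕ) ∧ (v : ℕ) < i + m := by
  simp only [pathCover, Finset.mem_filter_univ]
  have hlt : i % (m + 1) < m + 1 := Nat.mod_lt i m.succ_pos
  obtain h | h := Nat.eq_zero_or_pos (i % (m + 1))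
  · exact ⟨⟨i, by omega⟩, .inl ⟨h, hi⟩, by simp; omega⟩
  · refine ⟨⟨i + (m - i % (m + 1)), by omega⟩, .inr ?_, by simp; omega⟩
    rw [Fin.val_mk, show i + (m - i % (m + 1)) + 1 = m + 1 + (m + 1) * (i / (m + 1)) by
      have := Nat.mod_add_div i (m + 1); omega]
    simp

theorem exists_interval_of_mem_pathCover (hm : 1 ≤ m) {v : Fin n} (hv : v ∈ pathCover n m) :
    ∃ i, i + m ≤ n ∧ i ≤ (v : ℕ) ∧ (v : ℕ) < i + m ∧
      ∀ w ∈ pathCover n m, i ≤ (w : ℕ) → (w : ℕ) < i + m → w = v := by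
  have hmod : ∀ k r, r < m + 1 → ((m + 1) * k + r) % (m + 1) = r := fun k r hr ↦ by
    rw [Nat.mul_add_mod, Nat.mod_eq_of_lt hr]
  simp only [pathCover, Finset.mem_filter_univ] at hv ⊢
  obtain ⟨hv, hvn⟩ | hv := hv
  · obtain ⟨k, hk⟩ := Nat.dvd_of_mod_eq_zero hv
    refine ⟨v, hvn, le_rfl, by omega, fun w hw h₁ h₂ ↦ Fin.ext ?_⟩
    obtain ⟨r, hr⟩ := Nat.exists_eq_add_of_le h₁
    obtain ⟨hw, -⟩ | hw := hw
    · rw [hr, hk, hmod k r (by omega)] at hw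
      omega
    · rw [hr, hk, add_assoc, hmod k (r + 1) (by omega)] at hw
      omega
  · obtain ⟨k, hk⟩ := Nat.dvd_of_mod_eq_zero hv
    obtain _ | k := k
    · omega
    rw [mul_add_one] at hk
    have hvn := v.2
    refine ⟨(m + 1) * k + 1, by omega, by omega, by omega, fun w hw h₁ h₂ ↦ Fin.ext ?_⟩
    obtain ⟨r, hr⟩ := Nat.exists_eq_add_of_le h₁
    obtain ⟨hw, -⟩ | hw := hw
    · rw [hr, add_assoc, hmod k (1 + r) (by omega)] at hw
      omega
    · by_contra hne
      rw [hr, add_assoc, add_assoc, hmod k (1 + (r + 1)) (by omega)] at hw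
      omega

/-- The exponent of the product of the variables outside the cover `pathCover`. -/
noncomputable def pathCoverComplExp (n m : ℕ) : Fin n →₀ ℕ :=
  Finsupp.equivFunOnFinite.symm fun j ↦ if j ∈ pathCover n m then 0 else 1

theorem pathCoverComplExp_add_mem_pathExps_iff (hm : 1 ≤ m) (hn : m ≤ n) (a : Fin n →₀ ℕ) :
    pathCoverComplExp n m + a ∈ pathExps n m ∅ (n - m) n ↔
      ∃ v ∈ (pathCover n m : Set (Fin n)), a v ≠ 0 := by
  have hvar : ∀ p (hp : p < n), HasVar (pathCoverComplExp n m + a) p ↔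
      (⟨p, hp⟩ ∈ pathCover n m → a ⟨p, hp⟩ ≠ 0) := fun p hp ↦ by
    by_cases h : (⟨p, hp⟩ : Fin n) ∈ pathCover n m <;>
      simp [HasVar, hp, pathCoverComplExp, h]
  have hcover : ∀ i, i + m ≤ n →
      (∀ p, i ≤ p → p < i + m → HasVar (pathCoverComplExp n m + a) p) →
        ∃ v ∈ (pathCover n m : Set (Fin n)), a v ≠ 0 := fun i hi h ↦ by
    obtain ⟨v, hv, h₁, h₂⟩ := exists_mem_pathCover hm hi
    exact ⟨v, hv, (hvar v v.2).1 (h v h₁ h₂) hv⟩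
  constructor
  · rintro (⟨v, hv, -⟩ | ⟨i, hi, h⟩ | h)
    · simp at hv
    · exact hcover i hi h
    · exact hcover (n - m) (by omega) fun p h₁ h₂ ↦ h p h₁ (by omega)
  · rintro ⟨v, hv, hav⟩
    obtain ⟨i, hi, -, -, h⟩ := exists_interval_of_mem_pathCover hm (Finset.mem_coe.1 hv)
    refine .inr (.inl ⟨i, hi, fun p h₁ h₂ ↦ (hvar p (by omega)).2 fun hp ↦ ?_⟩)
    rwa [h _ hp h₁ h₂]

theorem pathGen_eq_monomial (K : Type) [Field K] (n m i : ℕ) :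
    pathGen K n m (i + 1) = monomial (intervalExp n i (i + m)) 1 := by
  have : intervalExp n i (i + m) = ∑ j ∈ Finset.univ.filter
      (fun j : Fin n ↦ i + 1 ≤ (j : ℕ) + 1 ∧ (j : ℕ) + 1 < i + 1 + m), Finsupp.single j 1 := by
    ext j
    rw [Finsupp.finsetSum_apply]
    simp only [Finsupp.single_apply, Finset.sum_ite_eq', Finset.mem_filter_univ,
      intervalExp_apply]
    exact if_congr (by omega) rfl rfl
  rw [this, monomial_sum_one]
  rfl

theorem pathIdeal_eq_monomialIdeal (K : Type) [Field K] (hn : m ≤ n) :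
    pathIdeal K n m = monomialIdeal K (pathExps n m ∅ (n - m) n) := by
  have hgen : {q | ∃ i : ℕ, 1 ≤ i ∧ i ≤ n - m + 1 ∧ q = pathGen K n m i} =
      (fun a ↦ monomial a (1 : K)) '' ((fun i ↦ intervalExp n i (i + m)) '' Set.Iic (n - m)) := by
    rw [Set.image_image]
    ext q
    constructor
    · rintro ⟨i, h₁, h₂, rfl⟩
      obtain ⟨i, rfl⟩ := Nat.exists_eq_add_of_le' h₁
      exact ⟨i, by simpa using h₂, (pathGen_eq_monomial K n m i).symm⟩
    · rintro ⟨i, hi, rfl⟩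
      exact ⟨i + 1, by omega, by simpa using hi, (pathGen_eq_monomial K n m i).symm⟩
  ext g
  rw [pathIdeal, hgen, mem_ideal_span_monomial_image,
    mem_monomialIdeal (isUpperSet_pathExps m ∅ (n - m) n)]
  refine forall₂_congr fun a _ ↦ ?_
  rw [Set.exists_mem_image]
  constructor
  · rintro ⟨i, hi, h⟩
    have hi : i + m ≤ n := by
      rw [Set.mem_Iic] at hi
      omega
    exact .inr (.inl ⟨i, hi, (intervalExp_le_iff hi).1 h⟩)
  · rintro (⟨v, hv, -⟩ | ⟨i, hi, h⟩ | h)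
    · simp at hv
    · exact ⟨i, by rw [Set.mem_Iic]; omega, (intervalExp_le_iff hi).2 h⟩
    · refine ⟨n - m, Set.mem_Iic.2 le_rfl, (intervalExp_le_iff (by omega)).2 fun p h₁ h₂ ↦ ?_⟩
      exact h p h₁ (by omega)

end Path

/-- `depth(S/I_{n,m}) = n + 1 − ⌊(n+1)/(m+1)⌋ − ⌈(n+1)/(m+1)⌉` for `n ≥ m ≥ 1`:
this value is the maximal length of an `(S/I_{n,m})`-regular sequence of homogeneous
elements of the graded maximal ideal `(x_1,…,x_n)`.  (In `ℕ`, `(n+1)/(m+1)` is the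
floor and `(n+m+1)/(m+1)` the ceiling of the rational number `(n+1)/(m+1)`.) -/
theorem stmt_0 (K : Type) [Field K] (n m : ℕ) (hm : 1 ≤ m) (hn : m ≤ n) :
    IsGreatest (homogRegSeqLengths K n (pathIdeal K n m))
      (n + 1 - (n + 1) / (m + 1) - (n + m + 1) / (m + 1)) := by
  have hdD : pathCoverCard n m ≤ n ∧
      n + 1 - (n + 1) / (m + 1) - (n + m + 1) / (m + 1) = n - pathCoverCard n m := by
    have hcard : (pathCover n m).card ≤ n := by simpa using Finset.card_le_univ (pathCover n m)
    have hpos : 1 ≤ (n + 1) / (m + 1) := (Nat.one_le_div_iff (by omega)).2 (by omega)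
    have hle := (pathCoverCard_le_card_pathCover hm hn).trans hcard
    refine ⟨hle, ?_⟩
    rw [pathCoverCard]
    generalize (n + 1) / (m + 1) = q, (n + m + 1) / (m + 1) = r at hpos ⊢
    omega
  have hIle : pathIdeal K n m ≤ Ideal.span (Set.range (X : Fin n → MvPolynomial (Fin n) K)) := by
    refine Ideal.span_le.2 ?_
    rintro _ ⟨i, h₁, h₂, rfl⟩
    refine Ideal.mem_of_dvd _ (Finset.dvd_prod_of_mem X (a := (⟨i - 1, by omega⟩ : Fin n)) ?_)
      (Ideal.subset_span ⟨_, rfl⟩)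
    simp only [Finset.mem_filter_univ]
    omega
  have hprime : (Ideal.span (Set.range (X : Fin n → MvPolynomial (Fin n) K))).IsPrime := by
    rw [← Set.image_univ]
    exact isPrime_span_X_image _
  rw [hdD.2]
  constructor
  · have hmem : ∀ f ∈ esymmList (Fin n) K (n - pathCoverCard n m), (∃ e : ℕ, f.IsHomogeneous e) ∧
        f ∈ Ideal.span (Set.range (X : Fin n → MvPolynomial (Fin n) K)) := by
      simp only [esymmList, List.mem_map]
      rintro _ ⟨i, -, rfl⟩
      exact ⟨⟨_, isHomogeneous_esymm _⟩, esymm_mem_span_range_X i.succ_ne_zero⟩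
    refine ⟨esymmList (Fin n) K (n - pathCoverCard n m), by simp [esymmList], hmem,
      Ideal.IsRegularMod.isRegular hprime.ne_top hIle (fun f hf ↦ (hmem f hf).2) ?_⟩
    rw [pathIdeal_eq_monomialIdeal K hn]
    refine isRegularMod_pathExps K hm (by omega) (by omega) le_rfl (by simp)
      (.inl (sub_lt_coverBound_pathCoverCard hn)) ?_
    rw [Finset.card_empty]
    omega
  · rintro _ ⟨rs, rfl, hrs, hreg⟩
    have hass : IsAssociatedPrime (Ideal.span (X '' (pathCover n m : Set (Fin n)) :
        Set (MvPolynomial (Fin n) K))) (MvPolynomial (Fin n) K ⧸ pathIdeal K n m) := by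
      rw [pathIdeal_eq_monomialIdeal K hn]
      exact isAssociatedPrime_quotient_monomialIdeal (isUpperSet_pathExps _ _ _ _)
        (pathCoverComplExp_add_mem_pathExps_iff hm hn)
    have hle := (hass.length_le_ringKrullDim (Ideal.span_mono (Set.image_subset_range _ _))
      (fun r hr ↦ (hrs r hr).2) hreg.toIsWeaklyRegular).trans
        (ringKrullDim_quotient_span_X_image_le (pathCover n m))
    rw [Fintype.card_fin] at hle
    exact (by exact_mod_cast hle : rs.length ≤ n - (pathCover n m).card).trans
      (Nat.sub_le_sub_left (pathCoverCard_le_card_pathCover hm hn) n)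
end

section
/- Let K be a field and n ≥ m ≥ 1 integers. The projective dimension of S/I_{n,m} as an S-module is 2(n−d)/(m+1) if n ≡ d (mod m+1) with 0 ≤ d ≤ m−1, and (2n−m+1)/(m+1) if n ≡ m (mod m+1). Equivalently, pd(S/I_{n,m}) = ⌊(n+1)/(m+1)⌋ + ⌈(n+1)/(m+1)⌉ − 1. -/
open MvPolynomial

open CategoryTheory CategoryTheory.Limits

section ProjectiveResolutionLength

variable {C : Type*} [Category* C] [Abelian C]

open Abelian

theorem hasProjectiveDimensionLT_of_projectiveResolution {X : C} (P : ProjectiveResolution X)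
    (d : ℕ) (hP : ∀ i, d < i → IsZero (P.complex.X i)) : HasProjectiveDimensionLT X (d + 1) := by
  let := HasExt.standard C
  refine HasProjectiveDimensionLT.mk fun i hi Y e ↦ ?_
  obtain ⟨f, hf, rfl⟩ := P.extMk_surjective e (i + 1) rfl
  obtain rfl : f = 0 := (hP i hi).eq_of_src _ _
  exact P.extMk_zero (i + 1) rfl

/-- The augmentation map of a projective resolution. -/
noncomputable def CategoryTheory.ProjectiveResolution.augmentation {X : C}
    (P : ProjectiveResolution X) :
    P.complex.X 0 ⟶ X :=
  P.π.f 0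

instance {X : C} (P : ProjectiveResolution X) : Epi P.augmentation :=
  inferInstanceAs (Epi (P.π.f 0))

@[simp]
theorem CategoryTheory.ProjectiveResolution.d_comp_augmentation {X : C}
    (P : ProjectiveResolution X) :
    P.complex.d 1 0 ≫ P.augmentation = 0 :=
  P.complex_d_comp_π_f_zero

theorem CategoryTheory.ProjectiveResolution.exact_augmentation {X : C}
    (P : ProjectiveResolution X) :
    (ShortComplex.mk _ _ P.d_comp_augmentation).Exact :=
  P.exact₀

theorem CategoryTheory.ProjectiveResolution.d_comp_augmentation_comp {X Y : C}
    (P : ProjectiveResolution X) (f : X ⟶ Y) : P.complex.d 1 0 ≫ P.augmentation ≫ f = 0 := by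
  rw [← Category.assoc, P.d_comp_augmentation, zero_comp]

theorem CategoryTheory.ProjectiveResolution.augment_d_comp {S : ShortComplex C}
    (P : ProjectiveResolution S.X₁) :
    (ChainComplex.augment P.complex (P.augmentation ≫ S.f)
      (P.d_comp_augmentation_comp S.f)).d 1 0 ≫ S.g = 0 := by
  change (P.augmentation ≫ S.f) ≫ S.g = 0
  simp

/-- Splicing a projective resolution of `S.X₁` with a short exact sequence `S` whose middle term
is projective gives a projective resolution of `S.X₃`. -/
noncomputable def CategoryTheory.ProjectiveResolution.splice {S : ShortComplex C}
    (hS : S.ShortExact) [Projective S.X₂] (P : ProjectiveResolution S.X₁) :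
    ProjectiveResolution S.X₃ where
  complex := ChainComplex.augment P.complex (P.augmentation ≫ S.f)
    (P.d_comp_augmentation_comp S.f)
  projective n := by
    cases n
    · assumption
    · exact P.projective _
  π := (ChainComplex.toSingle₀Equiv _ _).symm ⟨S.g, P.augment_d_comp⟩
  quasiIso := ⟨fun n => by
    cases n with
    | zero =>
      rw [ChainComplex.quasiIsoAt₀_iff, ShortComplex.quasiIso_iff_of_zeros']
      · dsimp
        refine (ShortComplex.exact_and_epi_g_iff_of_iso
          (S₂ := ShortComplex.mk (P.augmentation ≫ S.f) S.g (by simp)) ?_).2 ⟨?_, hS.epi_g⟩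
        · refine ShortComplex.isoMk (Iso.refl _) (Iso.refl _) (Iso.refl _)
            ((Category.id_comp _).trans (Category.comp_id _).symm) ?_
          refine (Category.id_comp _).trans (Eq.trans ?_ (Category.comp_id _).symm)
          exact (ChainComplex.toSingle₀Equiv_symm_apply_f_zero (X := S.X₃)
            (C := ChainComplex.augment P.complex (P.augmentation ≫ S.f) _) S.g P.augment_d_comp).symm
        · let φ : ShortComplex.mk (P.augmentation ≫ S.f) S.g (by simp) ⟶ S :=
            { τ₁ := P.augmentation
              τ₂ := 𝟙 _
              τ₃ := 𝟙 _ }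
          have : Epi φ.τ₁ := inferInstanceAs (Epi (P.augmentation))
          have : IsIso φ.τ₂ := inferInstanceAs (IsIso (𝟙 _))
          have : Mono φ.τ₃ := inferInstanceAs (Mono (𝟙 _))
          exact (ShortComplex.exact_iff_of_epi_of_isIso_of_mono φ).2 hS.exact
      all_goals rfl
    | succ n =>
      rw [quasiIsoAt_iff_exactAt' _ _ (ChainComplex.exactAt_succ_single_obj _ _),
        HomologicalComplex.exactAt_iff' _ (n + 1 + 1) (n + 1) n (by simp) (by simp)]
      cases n with
      | zero =>
        let φ : ShortComplex.mk (P.complex.d 1 0) (P.augmentation) P.d_comp_augmentation ⟶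
            ShortComplex.mk (P.complex.d 1 0) (P.augmentation ≫ S.f)
              (P.d_comp_augmentation_comp S.f) :=
          { τ₁ := 𝟙 _
            τ₂ := 𝟙 _
            τ₃ := S.f }
        have : Epi φ.τ₁ := inferInstanceAs (Epi (𝟙 _))
        have : IsIso φ.τ₂ := inferInstanceAs (IsIso (𝟙 _))
        have : Mono φ.τ₃ := hS.mono_f
        exact (ShortComplex.exact_iff_of_epi_of_isIso_of_mono φ).1 P.exact_augmentation
      | succ n => exact P.exact_succ n⟩

theorem exists_projectiveResolution_of_hasProjectiveDimensionLT [EnoughProjectives C] (d : ℕ)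
    (X : C) (hX : HasProjectiveDimensionLT X (d + 1)) :
    ∃ P : ProjectiveResolution X, ∀ i, d < i → IsZero (P.complex.X i) := by
  induction d generalizing X with
  | zero =>
    have : Projective X := projective_iff_hasProjectiveDimensionLT_one.2 hX
    exact ⟨ProjectiveResolution.self X, fun i hi ↦
      HomologicalComplex.isZero_single_obj_X _ _ _ _ (by omega)⟩
  | succ d ih =>
    let S := ShortComplex.mk (kernel.ι (Projective.π X)) (Projective.π X) (kernel.condition _)
    have hS : S.ShortExact :=
      { exact := ShortComplex.exact_of_f_is_kernel _ (kernelIsKernel _)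
        mono_f := inferInstanceAs (Mono (kernel.ι _))
        epi_g := inferInstanceAs (Epi (Projective.π X)) }
    have : Projective S.X₂ := Projective.projective_over X
    obtain ⟨P, hP⟩ := ih S.X₁ ((hS.hasProjectiveDimensionLT_X₃_iff d inferInstance).1 hX)
    refine ⟨P.splice hS, fun i hi ↦ ?_⟩
    obtain _ | i := i
    · omega
    · exact hP i (by omega)

theorem isLeast_projectiveResolution_length [EnoughProjectives C] [HasExt C] {X : C} {d : ℕ}
    (hX : HasProjectiveDimensionLT X (d + 1)) {Y : C} (hY : Nontrivial (Ext X Y d)) :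
    IsLeast {d : ℕ | ∃ P : ProjectiveResolution X, ∀ i, d < i → IsZero (P.complex.X i)} d := by
  refine ⟨exists_projectiveResolution_of_hasProjectiveDimensionLT d X hX, ?_⟩
  rintro d' ⟨P, hP⟩
  by_contra! hlt
  have := hasProjectiveDimensionLT_of_projectiveResolution P d' hP
  exact not_subsingleton (Ext X Y d) (HasProjectiveDimensionLT.subsingleton X (d' + 1) d hlt Y)

/-- If the first map of a short exact sequence factors through multiplication by a scalar
annihilating `Y`, then the connecting maps into `Ext S.X₃ Y` are injective; in particular they
preserve nontriviality. -/
theorem nontrivial_ext_succ_of_smul_eq_zero {R : Type*} [CommRing R] [Linear R C] [HasExt C]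
    {S : ShortComplex C} (hS : S.ShortExact) {Y : C} (x : R) (hx : x • 𝟙 Y = 0)
    (g : S.X₁ ⟶ S.X₂) (hg : S.f = x • g) (n : ℕ) [Nontrivial (Ext S.X₁ Y n)] :
    Nontrivial (Ext S.X₃ Y (n + 1)) := by
  obtain ⟨α, hα⟩ := exists_ne (0 : Ext S.X₁ Y n)
  refine nontrivial_of_ne (hS.extClass.comp α (add_comm 1 n)) 0 fun h ↦ hα ?_
  obtain ⟨β, rfl⟩ := Ext.contravariant_sequence_exact₁ hS Y α (add_comm 1 n) h
  rw [hg, Ext.mk₀_smul, Ext.smul_comp, Ext.smul_eq_comp_mk₀, hx, Ext.mk₀_zero, Ext.comp_zero]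

end ProjectiveResolutionLength

section ColonSequence

variable {R : Type} [CommRing R] {I J : Ideal R} {x g : R}

/-- The sequence `0 → R ⧸ J → R ⧸ I → R ⧸ (I ⊔ (f)) → 0` given by multiplication by `f = x * g`. -/
noncomputable def colonShortComplex (x : R) (hg : ∀ r ∈ J, g * r ∈ I) :
    ShortComplex (ModuleCat.{0} R) :=
  ShortComplex.mk
    (X₁ := ModuleCat.of R (R ⧸ J)) (X₂ := ModuleCat.of R (R ⧸ I))
    (X₃ := ModuleCat.of R (R ⧸ (I ⊔ Ideal.span {x * g})))
    (x • ModuleCat.ofHom (Submodule.mapQ J I (LinearMap.mulLeft R g) hg))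
    (ModuleCat.ofHom (Submodule.factor le_sup_left)) (by
      refine ModuleCat.hom_ext (LinearMap.ext fun r ↦ ?_)
      obtain ⟨r, rfl⟩ := Submodule.Quotient.mk_surjective _ r
      change Submodule.Quotient.mk (x * (g * r)) = 0
      rw [Submodule.Quotient.mk_eq_zero, ← mul_assoc]
      exact Ideal.mul_mem_right _ _ (Ideal.mem_sup_right (Ideal.mem_span_singleton_self _)))

theorem shortExact_colonShortComplex (hg : ∀ r ∈ J, g * r ∈ I)
    (hJ : ∀ r, x * g * r ∈ I → r ∈ J) : (colonShortComplex x hg).ShortExact where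
  exact := by
    rw [ShortComplex.moduleCat_exact_iff]
    intro r hr
    obtain ⟨r, rfl⟩ := Submodule.Quotient.mk_surjective _ r
    have hr : (Submodule.Quotient.mk r : R ⧸ (I ⊔ Ideal.span {x * g})) = 0 := hr
    rw [Submodule.Quotient.mk_eq_zero, Submodule.mem_sup] at hr
    obtain ⟨a, ha, b, hb, rfl⟩ := hr
    obtain ⟨c, rfl⟩ := Ideal.mem_span_singleton.1 hb
    refine ⟨Submodule.Quotient.mk c, ?_⟩
    change (Submodule.Quotient.mk (x * (g * c)) : R ⧸ I) = _
    rw [eq_comm, Submodule.Quotient.eq, mul_assoc, add_sub_cancel_right]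
    exact ha
  mono_f := by
    rw [ModuleCat.mono_iff_injective, injective_iff_map_eq_zero]
    intro r hr
    obtain ⟨r, rfl⟩ := Submodule.Quotient.mk_surjective _ r
    have hr : (Submodule.Quotient.mk (x * (g * r)) : R ⧸ I) = 0 := hr
    rw [Submodule.Quotient.mk_eq_zero, ← mul_assoc] at hr
    exact (Submodule.Quotient.mk_eq_zero _).2 (hJ r hr)
  epi_g := by
    rw [ModuleCat.epi_iff_surjective]
    exact Submodule.factor_surjective le_sup_left

end ColonSequence

section SquarefreeMonomialIdeal

variable (K : Type) [Field K] {σ : Type}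

/-- The ideal generated by the squarefree monomials with supports in `s`. -/
noncomputable def squarefreeIdeal (s : Set (Finset σ)) : Ideal (MvPolynomial σ K) :=
  Ideal.span ((fun A : Finset σ ↦ ∏ j ∈ A, X j) '' s)

/-- The residue field of `K[σ]` at the ideal generated by the variables, as a module. -/
noncomputable abbrev residueModule (σ : Type) : ModuleCat.{0} (MvPolynomial σ K) :=
  ModuleCat.of _ (MvPolynomial σ K ⧸ RingHom.ker (constantCoeff (σ := σ) (R := K)))

variable {K}

theorem prod_X_eq_monomial (A : Finset σ) :
    ∏ j ∈ A, (X j : MvPolynomial σ K) = monomial (∑ j ∈ A, Finsupp.single j 1) 1 := by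
  rw [monomial_sum_one]
  rfl

theorem sum_single_one_le_iff (A : Finset σ) (e : σ →₀ ℕ) :
    ∑ j ∈ A, Finsupp.single j 1 ≤ e ↔ A ⊆ e.support := by
  classical
  have h (i : σ) : (∑ j ∈ A, Finsupp.single j 1 : σ →₀ ℕ) i = if i ∈ A then 1 else 0 := by
    simp [Finsupp.finsetSum_apply, Finsupp.single_apply]
  refine ⟨fun hA i hi ↦ ?_, fun hA i ↦ ?_⟩
  · have := hA i
    rw [h, if_pos hi] at this
    exact Finsupp.mem_support_iff.2 (by omega)
  · rw [h]
    split_ifs with hi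
    · exact Nat.one_le_iff_ne_zero.2 (Finsupp.mem_support_iff.1 (hA hi))
    · exact Nat.zero_le _

theorem mem_squarefreeIdeal {s : Set (Finset σ)} {q : MvPolynomial σ K} :
    q ∈ squarefreeIdeal K s ↔ ∀ e ∈ q.support, ∃ A ∈ s, A ⊆ e.support := by
  have h : squarefreeIdeal K s = Ideal.span ((fun e ↦ monomial e (1 : K)) ''
      ((fun A : Finset σ ↦ ∑ j ∈ A, Finsupp.single j 1) '' s)) := by
    simp only [squarefreeIdeal, prod_X_eq_monomial, Set.image_image]
  simp [h, mem_ideal_span_monomial_image, sum_single_one_le_iff]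

theorem prod_X_mul_mem_squarefreeIdeal [DecidableEq σ] {s : Set (Finset σ)} {B : Finset σ}
    {q : MvPolynomial σ K} :
    (∏ j ∈ B, X j) * q ∈ squarefreeIdeal K s ↔
      ∀ e ∈ q.support, ∃ A ∈ s, A ⊆ B ∪ e.support := by
  have hB : (∑ j ∈ B, Finsupp.single j 1 : σ →₀ ℕ).support = B := by
    ext i
    simp [Finsupp.finsetSum_apply, Finsupp.single_apply]
  have h (b e : σ →₀ ℕ) : (b + e).support = b.support ∪ e.support := by
    ext i
    simp only [Finset.mem_union, Finsupp.mem_support_iff, Finsupp.add_apply]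
    omega
  rw [mem_squarefreeIdeal, prod_X_eq_monomial]
  refine ⟨fun H e he ↦ ?_, fun H e he ↦ ?_⟩
  · rw [← hB, ← h]
    refine H _ ?_
    rw [mem_support_iff, coeff_monomial_mul, one_mul]
    exact mem_support_iff.1 he
  · rw [mem_support_iff, coeff_monomial_mul'] at he
    split_ifs at he with hle
    · obtain ⟨e, rfl⟩ := exists_add_of_le hle
      rw [h, hB]
      refine H e (mem_support_iff.2 ?_)
      simpa using he
    · exact absurd rfl he

theorem squarefreeIdeal_insert (s : Set (Finset σ)) (B : Finset σ) :
    squarefreeIdeal K (insert B s) = squarefreeIdeal K s ⊔ Ideal.span {∏ j ∈ B, X j} := by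
  rw [squarefreeIdeal, Set.image_insert_eq, Ideal.span_insert, sup_comm]
  rfl

theorem X_smul_id_residueModule (v : σ) :
    (X v : MvPolynomial σ K) • 𝟙 (residueModule K σ) = 0 := by
  refine ModuleCat.hom_ext (LinearMap.ext fun r ↦ ?_)
  obtain ⟨r, rfl⟩ := Submodule.Quotient.mk_surjective _ r
  change Submodule.Quotient.mk (X v * r) = 0
  rw [Submodule.Quotient.mk_eq_zero]
  exact Ideal.mul_mem_right _ _ (by simp [RingHom.mem_ker])

open Abelian

variable (K) in
/-- The quotient by `squarefreeIdeal K s` has projective dimension exactly `d`, as witnessed by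
its `Ext` groups into the residue field. -/
structure HasResidualProjectiveDimension (s : Set (Finset σ)) (d : ℕ) : Prop where
  hasProjectiveDimensionLT : HasProjectiveDimensionLT
    (ModuleCat.of (MvPolynomial σ K) (MvPolynomial σ K ⧸ squarefreeIdeal K s)) (d + 1)
  nontrivial_ext : Nontrivial (Ext
    (ModuleCat.of (MvPolynomial σ K) (MvPolynomial σ K ⧸ squarefreeIdeal K s))
    (residueModule K σ) d)

theorem hasResidualProjectiveDimension_empty :
    HasResidualProjectiveDimension K (∅ : Set (Finset σ)) 0 := by
  have hbot : squarefreeIdeal K (∅ : Set (Finset σ)) = ⊥ := by simp [squarefreeIdeal]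
  constructor
  · rw [hbot, zero_add, ← projective_iff_hasProjectiveDimensionLT_one,
      ← IsProjective.iff_projective]
    exact Module.Projective.of_equiv (Submodule.quotEquivOfEqBot ⊥ rfl).symm
  · rw [hbot, Ext.homEquiv₀.nontrivial_congr]
    refine nontrivial_of_ne (ModuleCat.ofHom (Submodule.factor bot_le)) 0 fun h ↦ ?_
    have h1 : (Submodule.Quotient.mk 1 :
        MvPolynomial σ K ⧸ RingHom.ker (constantCoeff (σ := σ) (R := K))) = 0 :=
      congrArg (fun f ↦ f.hom (Submodule.Quotient.mk 1)) h
    rw [Submodule.Quotient.mk_eq_zero, RingHom.mem_ker, map_one] at h1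
    exact one_ne_zero h1

/-- Adding a squarefree monomial generator with support `B`, where `t` generates the colon ideal,
which is also the colon ideal by the monomial with support `B.erase v`. -/
theorem HasResidualProjectiveDimension.insert [DecidableEq σ] {s t : Set (Finset σ)}
    {B : Finset σ} {v : σ} (hv : v ∈ B) (hst : ∀ A ∈ s, ∃ A' ∈ t, A' ⊆ A \ B)
    (hts : ∀ A ∈ t, ∃ A' ∈ s, A' ⊆ B.erase v ∪ A) {d : ℕ}
    (ht : HasResidualProjectiveDimension K t d)
    (hs : HasProjectiveDimensionLT
      (ModuleCat.of (MvPolynomial σ K) (MvPolynomial σ K ⧸ squarefreeIdeal K s)) (d + 2)) :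
    HasResidualProjectiveDimension K (insert B s) (d + 1) := by
  have hB : ∏ j ∈ B, (X j : MvPolynomial σ K) = X v * ∏ j ∈ B.erase v, X j :=
    (Finset.mul_prod_erase B _ hv).symm
  have hg : ∀ r ∈ squarefreeIdeal K t, (∏ j ∈ B.erase v, X j) * r ∈ squarefreeIdeal K s := by
    intro r hr
    rw [prod_X_mul_mem_squarefreeIdeal]
    intro e he
    obtain ⟨A, hA, hAe⟩ := mem_squarefreeIdeal.1 hr e he
    obtain ⟨A', hA', hA'A⟩ := hts A hA
    exact ⟨A', hA', hA'A.trans (Finset.union_subset_union_right hAe)⟩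
  have hJ : ∀ r, X v * (∏ j ∈ B.erase v, X j) * r ∈ squarefreeIdeal K s →
      r ∈ squarefreeIdeal K t := by
    intro r hr
    rw [← hB, prod_X_mul_mem_squarefreeIdeal] at hr
    rw [mem_squarefreeIdeal]
    intro e he
    obtain ⟨A, hA, hAe⟩ := hr e he
    obtain ⟨A', hA', hA'A⟩ := hst A hA
    refine ⟨A', hA', fun i hi ↦ ?_⟩
    have hi' := Finset.mem_sdiff.1 (hA'A hi)
    exact (Finset.mem_union.1 (hAe hi'.1)).resolve_left hi'.2
  have hS := shortExact_colonShortComplex hg hJ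
  have : Nontrivial (Ext (colonShortComplex (X v) hg).X₁ (residueModule K σ) d) :=
    ht.nontrivial_ext
  constructor
  · rw [squarefreeIdeal_insert, hB]
    exact hS.hasProjectiveDimensionLT_X₃ (d + 1) ht.hasProjectiveDimensionLT hs
  · rw [squarefreeIdeal_insert, hB]
    exact nontrivial_ext_succ_of_smul_eq_zero hS (X v : MvPolynomial σ K)
      (X_smul_id_residueModule v) _ rfl d

end SquarefreeMonomialIdeal

section PathIdeal

/-- The support of the generator `u_i` of the path ideal. -/
def pathSupport (n m i : ℕ) : Finset (Fin n) :=
  Finset.univ.filter fun j ↦ i ≤ (j : ℕ) + 1 ∧ (j : ℕ) + 1 < i + m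

/-- The supports of the generators of the path ideal involving only the first `k` variables. -/
def pathSupports (n m k : ℕ) : Set (Finset (Fin n)) :=
  {A | ∃ i, 1 ≤ i ∧ i + m ≤ k + 1 ∧ A = pathSupport n m i}

/-- The projective dimension of the quotient by the path ideal of the line graph on `k` vertices. -/
def pathDim (m k : ℕ) : ℕ :=
  2 * (k / (m + 1)) + if k % (m + 1) = m then 1 else 0

variable {n m k : ℕ}

theorem mem_pathSupport {i : ℕ} {j : Fin n} :
    j ∈ pathSupport n m i ↔ i ≤ (j : ℕ) + 1 ∧ (j : ℕ) + 1 < i + m := by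
  simp [pathSupport]

theorem squarefreeIdeal_pathSupports (K : Type) [Field K] (hn : m ≤ n) :
    squarefreeIdeal K (pathSupports n m n) = pathIdeal K n m := by
  rw [squarefreeIdeal, pathIdeal]
  congr 1
  ext q
  constructor
  · rintro ⟨_, ⟨i, hi, hi', rfl⟩, rfl⟩
    exact ⟨i, hi, by omega, rfl⟩
  · rintro ⟨i, hi, hi', rfl⟩
    exact ⟨_, ⟨i, hi, by omega, rfl⟩, rfl⟩

theorem pathSupports_of_lt (hk : k < m) : pathSupports n m k = ∅ := by
  refine Set.eq_empty_of_forall_notMem ?_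
  rintro _ ⟨i, hi, hi', -⟩
  omega

theorem pathSupports_succ (hk : m ≤ k + 1) :
    pathSupports n m (k + 1) = insert (pathSupport n m (k + 2 - m)) (pathSupports n m k) := by
  ext A
  constructor
  · rintro ⟨i, hi, hi', rfl⟩
    obtain h | h := Nat.lt_or_ge (k + 1) (i + m)
    · obtain rfl : i = k + 2 - m := by omega
      exact Or.inl rfl
    · exact Or.inr ⟨i, hi, h, rfl⟩
  · rintro (rfl | ⟨i, hi, hi', rfl⟩)
    · exact ⟨_, by omega, by omega, rfl⟩
    · exact ⟨i, hi, by omega, rfl⟩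

theorem pathDim_of_lt (hk : k < m) : pathDim m k = 0 := by
  rw [pathDim, Nat.div_eq_of_lt (by omega), Nat.mod_eq_of_lt (by omega), if_neg (by omega)]

theorem pathDim_self : pathDim m m = 1 := by
  rw [pathDim, Nat.div_eq_of_lt (by omega), Nat.mod_eq_of_lt (by omega), if_pos rfl]

theorem pathDim_add : pathDim m (k + (m + 1)) = pathDim m k + 2 := by
  rw [pathDim, pathDim, Nat.add_div_right _ (by omega), Nat.add_mod_right]
  omega

theorem pathDim_le_succ : pathDim m k ≤ pathDim m (k + 1) := by
  have hle : k / (m + 1) ≤ (k + 1) / (m + 1) := Nat.div_le_div_right (Nat.le_succ k)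
  rw [pathDim, pathDim]
  split_ifs with h1 h2
  · omega
  · have h := Nat.mod_add_div k (m + 1)
    have : (k + 1) / (m + 1) = k / (m + 1) + 1 := by
      refine Nat.div_eq_of_eq_mul_right (by omega) ?_
      rw [mul_add]
      omega
    omega
  all_goals omega

theorem pathDim_eq (hn : m ≤ n) :
    pathDim m n = if n % (m + 1) = m then (2 * n - m + 1) / (m + 1)
        else 2 * (n - n % (m + 1)) / (m + 1) := by
  have h := Nat.mod_add_div n (m + 1)
  rw [pathDim]
  generalize n / (m + 1) = q at h ⊢
  split_ifs with hm
  · rw [hm] at h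
    refine (Nat.div_eq_of_eq_mul_right (by omega) ?_).symm
    have : (m + 1) * (2 * q + 1) = 2 * ((m + 1) * q) + (m + 1) := by ring
    omega
  · refine (Nat.div_eq_of_eq_mul_right (by omega) ?_).symm
    have : (m + 1) * (2 * q + 0) = 2 * ((m + 1) * q) := by ring
    omega

theorem pathDim_eq_floor_add_ceil :
    pathDim m n = (n + 1) / (m + 1) + (n + m + 1) / (m + 1) - 1 := by
  have h := Nat.mod_add_div n (m + 1)
  have hlt : n % (m + 1) < m + 1 := Nat.mod_lt n (by omega)
  have hadd : n + m + 1 = n + (m + 1) := rfl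
  rw [pathDim, hadd, Nat.add_div_right _ (by omega)]
  generalize n / (m + 1) = q at h ⊢
  split_ifs with hm
  · have : (n + 1) / (m + 1) = q + 1 := by
      refine Nat.div_eq_of_eq_mul_right (by omega) ?_
      have : (m + 1) * (q + 1) = (m + 1) * q + (m + 1) := by ring
      omega
    omega
  · have : (n + 1) / (m + 1) = q := by
      refine Nat.div_eq_of_lt_le ?_ ?_
      · have : q * (m + 1) = (m + 1) * q := by ring
        omega
      · have : (q + 1) * (m + 1) = (m + 1) * q + (m + 1) := by ring
        omega
    omega

theorem hasResidualProjectiveDimension_pathSupports (K : Type) [Field K] (hm : 1 ≤ m)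
    (hk : k ≤ n) : HasResidualProjectiveDimension K (pathSupports n m k) (pathDim m k) := by
  induction k using Nat.strong_induction_on with
  | _ k ih =>
    obtain hkm | rfl | hkm := lt_trichotomy k m
    · rw [pathSupports_of_lt hkm, pathDim_of_lt hkm]
      exact hasResidualProjectiveDimension_empty
    · obtain ⟨k, rfl⟩ := Nat.exists_eq_add_of_le' hm
      have h0 : HasResidualProjectiveDimension K (∅ : Set (Finset (Fin n))) 0 :=
        hasResidualProjectiveDimension_empty
      rw [pathSupports_succ le_rfl, pathSupports_of_lt (Nat.lt_succ_self k), pathDim_self]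
      have := h0.hasProjectiveDimensionLT
      exact h0.insert (v := ⟨k, hk⟩) (mem_pathSupport.2 (by dsimp only; omega))
        (by simp) (by simp) inferInstance
    · obtain ⟨l, rfl⟩ : ∃ l, k = l + (m + 1) := ⟨k - (m + 1), by omega⟩
      have hl := ih l (by omega) (by omega)
      have hp := ih (l + m) (by omega) (by omega)
      let w : Fin n := ⟨l, by omega⟩
      have hlp : ∀ A ∈ pathSupports n m l, w ∉ A := by
        rintro _ ⟨i, hi, hi', rfl⟩ hw
        have := mem_pathSupport.1 hw
        dsimp only [w] at this
        omega
      have := hl.hasProjectiveDimensionLT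
      have hw : HasResidualProjectiveDimension K (insert {w} (pathSupports n m l))
          (pathDim m l + 1) :=
        hl.insert (v := w) (by simp)
          (fun A hA ↦ ⟨A, hA, Finset.subset_sdiff.2
            ⟨subset_rfl, Finset.disjoint_singleton_right.2 (hlp A hA)⟩⟩)
          (fun A hA ↦ ⟨A, hA, Finset.subset_union_right⟩)
          (hasProjectiveDimensionLT_of_ge _ (pathDim m l + 1) _ (by omega))
      have hle : pathDim m (l + m) ≤ pathDim m l + 2 := pathDim_add ▸ pathDim_le_succ
      have := hp.hasProjectiveDimensionLT
      rw [pathDim_add, ← add_assoc, pathSupports_succ (by omega)]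
      refine hw.insert (v := ⟨l + m, by omega⟩) (mem_pathSupport.2 (by dsimp only; omega)) ?_ ?_
        (hasProjectiveDimensionLT_of_ge _ (pathDim m (l + m) + 1) _ (by omega))
      · rintro _ ⟨i, hi, hi', rfl⟩
        obtain h | h := Nat.lt_or_ge (l + 1) (i + m)
        · refine ⟨{w}, Or.inl rfl, ?_⟩
          simp only [Finset.singleton_subset_iff, Finset.mem_sdiff, mem_pathSupport, w]
          omega
        · refine ⟨pathSupport n m i, Or.inr ⟨i, hi, h, rfl⟩, fun j hj ↦ ?_⟩
          simp only [Finset.mem_sdiff, mem_pathSupport] at hj ⊢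
          omega
      · rintro _ (rfl | ⟨i, hi, hi', rfl⟩)
        · refine ⟨_, ⟨l + 1, by omega, by omega, rfl⟩, fun j hj ↦ ?_⟩
          simp only [Finset.mem_union, Finset.mem_erase, Finset.mem_singleton, mem_pathSupport,
            Fin.ext_iff, ne_eq, w] at hj ⊢
          omega
        · exact ⟨_, ⟨i, hi, by omega, rfl⟩, Finset.subset_union_right⟩

end PathIdeal

/-- `pd(S/I_{n,m})`, the minimal length of a projective resolution of `S/I_{n,m}`,
equals `2(n−d)/(m+1)` if `n ≡ d (mod m+1)` with `0 ≤ d ≤ m−1` (i.e. `n % (m+1) ≠ m`),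
and `(2n−m+1)/(m+1)` if `n ≡ m (mod m+1)`; equivalently it equals
`⌊(n+1)/(m+1)⌋ + ⌈(n+1)/(m+1)⌉ − 1`.  Here a projective resolution has length `≤ d`
iff its terms vanish in homological degrees `> d`, and `pd` is the least such `d`. -/
theorem stmt_1 (K : Type) [Field K] (n m : ℕ) (hm : 1 ≤ m) (hn : m ≤ n) :
    IsLeast
      {d : ℕ | ∃ P : ProjectiveResolution (ModuleCat.of (MvPolynomial (Fin n) K)
          (MvPolynomial (Fin n) K ⧸ pathIdeal K n m)),
        ∀ i : ℕ, d < i → IsZero (P.complex.X i)}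
      (if n % (m + 1) = m then (2 * n - m + 1) / (m + 1)
        else 2 * (n - n % (m + 1)) / (m + 1)) ∧
    (if n % (m + 1) = m then (2 * n - m + 1) / (m + 1)
        else 2 * (n - n % (m + 1)) / (m + 1)) =
      (n + 1) / (m + 1) + (n + m + 1) / (m + 1) - 1 := by
  rw [← pathDim_eq hn]
  refine ⟨?_, pathDim_eq_floor_add_ceil⟩
  have h := hasResidualProjectiveDimension_pathSupports K hm (le_refl n)
  rw [← squarefreeIdeal_pathSupports K hn]
  exact isLeast_projectiveResolution_length h.hasProjectiveDimensionLT h.nontrivial_ext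
end

section
/- Let K be a field, m ≥ 3 and n ≥ 2m integers, k = ⌊(n+1)/(m+1)⌋, and suppose 1 < a < m−1 where a = n+1 − k(m+1). For 1 ≤ j ≤ k−1, let L_{j-1} = (I_{n,m} : x_m x_{2m+1} ⋯ x_{(j-1)(m+1)−1}) (with L_0 = I_{n,m}) and U_j = L_{j−1} + (x_{j(m+1)−1}). Then depth(S/U_j) = n + 2 − ⌊(n+2)/(m+1)⌋ − ⌈(n+2)/(m+1)⌉, and in particular depth(S/U_j) ≥ n + 1 − ⌊(n+1)/(m+1)⌋ − ⌈(n+1)/(m+1)⌉. -/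
open MvPolynomial

open scoped Pointwise in
/-- A regular sequence inside a maximal ideal `𝔪` is no longer than the coheight of any
associated prime contained in `𝔪`. -/
theorem length_le_coheight_of_isWeaklyRegular {R : Type*} [CommRing R] [IsNoetherianRing R]
    (𝔪 : Ideal R) [h𝔪 : 𝔪.IsMaximal] (rs : List R) :
    ∀ {M : Type*} [AddCommGroup M] [Module R M] [Module.Finite R M],
      (∀ r ∈ rs, r ∈ 𝔪) → RingTheory.Sequence.IsWeaklyRegular M rs →
      ∀ P : PrimeSpectrum R, IsAssociatedPrime P.asIdeal M → P.asIdeal ≤ 𝔪 →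
        (rs.length : ℕ∞) ≤ Order.coheight P := by
  induction rs with
  | nil => intros; simp
  | cons x rs ih =>
    intro M _ _ _ hmem hreg P hP hPm
    rw [RingTheory.Sequence.isWeaklyRegular_cons_iff] at hreg
    obtain ⟨hx, hrs⟩ := hreg
    have hxm : x ∈ 𝔪 := hmem x List.mem_cons_self
    obtain ⟨-, y, hy⟩ := isAssociatedPrime_iff.mp hP
    have hyP : ∀ r, r ∈ P.asIdeal ↔ r • y = 0 := by
      intro r
      rw [hy]; simp [Submodule.mem_colon_singleton]
    let N : Submodule R M := Submodule.torsionBySet R M P.asIdeal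
    have hN : ∀ z, z ∈ N ↔ ∀ p ∈ P.asIdeal, p • z = 0 := by
      intro z; simp [N, Submodule.mem_torsionBySet_iff]
    have hyN : y ∈ N := (hN y).mpr fun p hp => (hyP p).mp hp
    let N' : Submodule R (QuotSMulTop x M) := N.map (Submodule.mkQ _)
    have hN' : ∀ s, s ∈ Module.annihilator R N' ↔ ∀ z ∈ N, ∃ w, x • w = s • z := by
      intro s
      refine Submodule.mem_annihilator.trans ⟨fun h z hz => ?_, ?_⟩
      · have hz' := h _ (Submodule.mem_map_of_mem hz)
        rw [← map_smul, Submodule.mkQ_apply, Submodule.Quotient.mk_eq_zero,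
          Submodule.mem_smul_pointwise_iff_exists] at hz'
        obtain ⟨w, -, hw⟩ := hz'
        exact ⟨w, hw⟩
      · rintro h _ ⟨z, hz, rfl⟩
        obtain ⟨w, hw⟩ := h z hz
        rw [← map_smul, Submodule.mkQ_apply, Submodule.Quotient.mk_eq_zero, ← hw]
        exact Submodule.smul_mem_pointwise_smul _ _ _ trivial
    have hann : Module.annihilator R N' ≤ 𝔪 := by
      intro s hs
      by_contra hsm
      obtain ⟨t, c, hc, htc⟩ := h𝔪.exists_inv hsm
      have hle : N ≤ 𝔪 • N := by
        intro z hz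
        obtain ⟨w, hw⟩ := (hN' s).mp hs z hz
        have hwN : w ∈ N := by
          rw [hN]
          intro p hp
          apply hx
          simp only [smul_zero]
          rw [smul_comm, hw, smul_comm, (hN z).mp hz p hp, smul_zero]
        have hzeq : z = x • (t • w) + c • z := by
          rw [smul_comm x t w, hw, ← mul_smul, ← add_smul, htc, one_smul]
        rw [hzeq]
        exact add_mem (Submodule.smul_mem_smul hxm (N.smul_mem _ hwN))
          (Submodule.smul_mem_smul hc hz)
      obtain ⟨r, hr, hrN⟩ := Submodule.exists_mem_and_smul_eq_self_of_fg_of_le_smul 𝔪 N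
        (IsNoetherian.noetherian N) hle
      have h1 : 1 - r ∈ P.asIdeal := by
        rw [hyP, sub_smul, one_smul, hrN y hyN, sub_self]
      exact h𝔪.ne_top ((Ideal.eq_top_iff_one _).mpr (by simpa using add_mem (hPm h1) hr))
    obtain ⟨Q, hQ, hQm⟩ := Ideal.exists_minimalPrimes_le hann
    have hannQ : Module.annihilator R N' ≤ Q := hQ.1.2
    have hQass : IsAssociatedPrime Q (QuotSMulTop x M) :=
      associatedPrimes.subset_of_injective N'.subtype_injective
        (Module.associatedPrimes.minimalPrimes_annihilator_subset_associatedPrimes R N' hQ)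
    have hPQ : P < ⟨Q, hQass.isPrime⟩ := by
      change P.asIdeal < Q
      refine lt_of_le_of_ne (le_trans (fun p hp => ?_) hannQ) ?_
      · exact (hN' p).mpr fun z hz => ⟨0, by rw [smul_zero, (hN z).mp hz p hp]⟩
      · intro h
        have hxQ : x ∈ Q := hannQ ((hN' x).mpr fun z _ => ⟨z, rfl⟩)
        rw [← h, hyP] at hxQ
        have hy0 : y = 0 := hx (by simpa using hxQ)
        exact P.isPrime.ne_top ((Ideal.eq_top_iff_one _).mpr (by rw [hyP, hy0, smul_zero]))
    have := ih (M := QuotSMulTop x M) (fun r hr => hmem r (List.mem_cons_of_mem _ hr)) hrs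
      ⟨Q, hQass.isPrime⟩ hQass hQm
    calc ((x :: rs).length : ℕ∞) = rs.length + 1 := by simp
      _ ≤ Order.coheight (⟨Q, hQass.isPrime⟩ : PrimeSpectrum R) + 1 := by gcongr
      _ ≤ Order.coheight P := Order.coheight_add_one_le hPQ

theorem isPrime_span_X_image (K : Type*) [Field K] {σ : Type*} (C : Set σ) :
    (Ideal.span (X '' C : Set (MvPolynomial σ K))).IsPrime := by
  classical
  set P : Ideal (MvPolynomial σ K) := Ideal.span (X '' C) with hP
  let φ : MvPolynomial σ K →ₐ[K] MvPolynomial σ K := aeval fun i => if i ∈ C then 0 else X i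
  have hcomp : (Ideal.Quotient.mkₐ K P).comp φ = Ideal.Quotient.mkₐ K P := by
    refine MvPolynomial.algHom_ext fun i => ?_
    by_cases hi : i ∈ C
    · have : Ideal.Quotient.mkₐ K P (X i) = 0 := by
        rw [Ideal.Quotient.mkₐ_eq_mk, Ideal.Quotient.eq_zero_iff_mem]
        exact Ideal.subset_span ⟨i, hi, rfl⟩
      simp only [AlgHom.comp_apply, φ, aeval_X, if_pos hi, map_zero, this]
    · simp only [AlgHom.comp_apply, φ, aeval_X, if_neg hi]
  have hker : P = RingHom.ker φ := by
    apply le_antisymm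
    · rw [hP, Ideal.span_le]
      rintro _ ⟨i, hi, rfl⟩
      simp [φ, hi]
    · intro f hf
      have := congrArg (fun ψ => ψ f) hcomp
      simp only [AlgHom.comp_apply, RingHom.mem_ker.mp hf, map_zero] at this
      rw [Ideal.Quotient.mkₐ_eq_mk] at this
      exact Ideal.Quotient.eq_zero_iff_mem.mp this.symm
  rw [hker]
  exact RingHom.ker_isPrime _

theorem X_mem_span_X_image_iff {K : Type*} [Field K] {σ : Type*} (C : Set σ) (i : σ) :
    X i ∈ Ideal.span (X '' C : Set (MvPolynomial σ K)) ↔ i ∈ C := by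
  classical
  rw [mem_ideal_span_X_image]
  simp [support_X, Finsupp.single_apply]

/-- The prime ideal of `K[x_σ]` generated by the variables with index in `C`. -/
noncomputable def variablePrime (K : Type*) [Field K] {σ : Type*} (C : Set σ) :
    PrimeSpectrum (MvPolynomial σ K) :=
  ⟨Ideal.span (X '' C), isPrime_span_X_image K C⟩

theorem card_le_height_variablePrime (K : Type*) [Field K] {σ : Type*} [DecidableEq σ]
    (C : Finset σ) : (C.card : ℕ∞) ≤ Order.height (variablePrime K (C : Set σ)) := by
  induction C using Finset.induction_on with
  | empty => simp
  | insert a s ha ih =>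
    have hlt : variablePrime K (s : Set σ) < variablePrime K (insert a s : Finset σ) := by
      change Ideal.span _ < Ideal.span _
      refine lt_of_le_of_ne (Ideal.span_mono (Set.image_mono (by simp))) fun h => ?_
      have := (X_mem_span_X_image_iff (K := K) (insert a s : Finset σ) a).mpr (by simp)
      rw [← h, X_mem_span_X_image_iff] at this
      exact ha (by simpa using this)
    rw [Finset.card_insert_of_notMem ha, Nat.cast_add, Nat.cast_one]
    exact le_trans (by gcongr) (Order.height_add_one_le hlt)

theorem coheight_variablePrime_add_card_le (K : Type*) [Field K] {n : ℕ} (C : Finset (Fin n)) :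
    Order.coheight (variablePrime K (C : Set (Fin n))) + C.card ≤ n := by
  have hdim : ringKrullDim (MvPolynomial (Fin n) K) = n := by
    rw [ringKrullDim_of_isNoetherianRing, ringKrullDim_eq_zero_of_field]; simp
  have h1 := card_le_height_variablePrime K C
  have h2 := le_iSup (fun a : PrimeSpectrum (MvPolynomial (Fin n) K) =>
    Order.height a + Order.coheight a) (variablePrime K (C : Set (Fin n)))
  rw [ringKrullDim, Order.krullDim_eq_iSup_height_add_coheight_of_nonempty] at hdim
  have h3 : (⨆ a : PrimeSpectrum (MvPolynomial (Fin n) K),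
    Order.height a + Order.coheight a) = n := by exact_mod_cast hdim
  rw [h3] at h2
  calc _ ≤ Order.coheight (variablePrime K (C : Set (Fin n))) +
        Order.height (variablePrime K (C : Set (Fin n))) := by gcongr
    _ ≤ n := by rw [add_comm]; exact h2

theorem MvPolynomial.IsHomogeneous.add_pow_pow {K σ : Type*} [CommSemiring K]
    {f g : MvPolynomial σ K} {d e : ℕ} (hf : f.IsHomogeneous d) (hg : g.IsHomogeneous e) :
    (f ^ e + g ^ d).IsHomogeneous (d * e) :=
  (hf.pow e).add (by rw [mul_comm]; exact hg.pow d)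

/-- Homogeneous prime avoidance for the graded maximal ideal of a polynomial ring. -/
theorem exists_isHomogeneous_forall_notMem {K σ : Type*} [Field K]
    (s : Finset (Ideal (MvPolynomial σ K))) (hs : ∀ P ∈ s, P.IsPrime)
    (hle : ∀ P ∈ s, ∃ i, X i ∉ P) (hne : Nonempty σ) :
    ∃ f ∈ Ideal.span (Set.range (X : σ → MvPolynomial σ K)), ∃ e, 0 < e ∧ f.IsHomogeneous e ∧
      ∀ P ∈ s, f ∉ P := by
  classical
  induction hc : s.card using Nat.strong_induction_on generalizing s with
  | _ c ih =>
    obtain rfl | ⟨Q, hQ⟩ := s.eq_empty_or_nonempty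
    · obtain ⟨i⟩ := hne
      exact ⟨X i, Ideal.subset_span ⟨i, rfl⟩, 1, one_pos, isHomogeneous_X K i, by simp⟩
    have hcard : (s.erase Q).card < c := hc ▸ Finset.card_erase_lt_of_mem hQ
    have hQp := hs Q hQ
    by_cases hA : ∀ P ∈ s.erase Q, ∃ g d, g.IsHomogeneous d ∧ g ∈ P ∧ g ∉ Q
    · obtain ⟨f, hfm, e, he, hfe, hf⟩ := ih _ hcard (s.erase Q)
        (fun P hP => hs P (Finset.mem_of_mem_erase hP))
        (fun P hP => hle P (Finset.mem_of_mem_erase hP)) rfl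
      by_cases hfQ : f ∈ Q
      · choose! g d hg using hA
        obtain ⟨i, hi⟩ := hle Q hQ
        have hG : (X i * ∏ P ∈ s.erase Q, g P).IsHomogeneous (1 + ∑ P ∈ s.erase Q, d P) :=
          (isHomogeneous_X K i).mul (IsHomogeneous.prod _ _ _ fun P hP => (hg P hP).1)
        have hGQ : X i * ∏ P ∈ s.erase Q, g P ∉ Q := by
          intro h
          rcases hQp.mem_or_mem h with h | h
          · exact hi h
          · obtain ⟨P, hP, h⟩ := hQp.prod_mem_iff.mp h
            exact (hg P hP).2.2 h
        have hGm : X i * ∏ P ∈ s.erase Q, g P ∈ Ideal.span (Set.range (X : σ → _)) :=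
          Ideal.mul_mem_right _ _ (Ideal.subset_span ⟨i, rfl⟩)
        have hGP : ∀ P ∈ s.erase Q, X i * ∏ P ∈ s.erase Q, g P ∈ P := fun P hP =>
          Ideal.mul_mem_left _ _ (Ideal.mem_of_dvd _ (Finset.dvd_prod_of_mem g hP) (hg P hP).2.1)
        set G := X i * ∏ P ∈ s.erase Q, g P
        refine ⟨_, ?_, _, ?_, IsHomogeneous.add_pow_pow hfe hG, fun P hP => ?_⟩
        · exact add_mem (Ideal.pow_mem_of_mem _ hfm _ (by omega))
            (Ideal.pow_mem_of_mem _ hGm _ he)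
        · positivity
        · by_cases hPQ : P = Q
          · subst hPQ
            rw [Ideal.add_mem_iff_right _ (Ideal.pow_mem_of_mem _ hfQ _ (by omega))]
            exact fun h => hGQ (hQp.mem_of_pow_mem _ h)
          · have hP' := Finset.mem_erase.mpr ⟨hPQ, hP⟩
            rw [Ideal.add_mem_iff_left _ (Ideal.pow_mem_of_mem _ (hGP P hP') _ he)]
            exact fun h => hf P hP' ((hs P hP).mem_of_pow_mem _ h)
      · refine ⟨f, hfm, e, he, hfe, fun P hP => ?_⟩
        by_cases hPQ : P = Q
        · rwa [hPQ]
        · exact hf P (Finset.mem_erase.mpr ⟨hPQ, hP⟩)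
    · push Not at hA
      obtain ⟨P, hP, hPQ⟩ := hA
      have hPs := Finset.mem_of_mem_erase hP
      obtain ⟨f, hfm, e, he, hfe, hf⟩ := ih _ (hc ▸ Finset.card_erase_lt_of_mem hPs) (s.erase P)
        (fun P hP => hs P (Finset.mem_of_mem_erase hP))
        (fun P hP => hle P (Finset.mem_of_mem_erase hP)) rfl
      refine ⟨f, hfm, e, he, hfe, fun P' hP' => ?_⟩
      by_cases h : P' = P
      · subst h
        exact fun hfP => hf Q (Finset.mem_erase.mpr ⟨(Finset.ne_of_mem_erase hP).symm, hQ⟩)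
          (hPQ f e hfe hfP)
      · exact hf P' (Finset.mem_erase.mpr ⟨h, hP'⟩)

open CategoryTheory Abelian in
/-- `S ⧸ I` has codepth at most `r`, in terms of the vanishing of `Ext(S ⧸ (x₁, …, xₙ), S ⧸ I)`. -/
def HasCodepthLE {K : Type} [Field K] {n : ℕ} (I : Ideal (MvPolynomial (Fin n) K)) (r : ℕ) :
    Prop :=
  ∀ i, i + r < n → Subsingleton (Ext
    (ModuleCat.of (MvPolynomial (Fin n) K) (MvPolynomial (Fin n) K ⧸
      Ideal.span (Set.range (X : Fin n → MvPolynomial (Fin n) K))))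
    (ModuleCat.of (MvPolynomial (Fin n) K) (MvPolynomial (Fin n) K ⧸ I)) i)

theorem HasCodepthLE.mono {K : Type} [Field K] {n : ℕ} {I : Ideal (MvPolynomial (Fin n) K)}
    {r s : ℕ} (h : HasCodepthLE I r) (hrs : r ≤ s) : HasCodepthLE I s :=
  fun i hi => h i (by omega)

open CategoryTheory Abelian Limits in
/-- The mapping cone bound coming from `0 → S ⧸ (I : f) → S ⧸ I → S ⧸ (I + (f)) → 0`. -/
theorem HasCodepthLE.sup_span_singleton {K : Type} [Field K] {n : ℕ}
    {I J : Ideal (MvPolynomial (Fin n) K)} {f : MvPolynomial (Fin n) K} {r : ℕ}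
    (hJ : ∀ g, g ∈ J ↔ g * f ∈ I) (hI : HasCodepthLE I (r + 1)) (hcolon : HasCodepthLE J r) :
    HasCodepthLE (I ⊔ Ideal.span {f}) (r + 1) := by
  intro i hi
  let φ : (MvPolynomial (Fin n) K ⧸ J) →ₗ[MvPolynomial (Fin n) K] (MvPolynomial (Fin n) K ⧸ I) :=
    Submodule.mapQ J I (LinearMap.mulRight _ f) fun g hg => (hJ g).mp hg
  let ψ : (MvPolynomial (Fin n) K ⧸ I) →ₗ[MvPolynomial (Fin n) K]
      (MvPolynomial (Fin n) K ⧸ I ⊔ Ideal.span {f}) :=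
    Submodule.mapQ I (I ⊔ Ideal.span {f}) LinearMap.id fun g hg => Ideal.mem_sup_left hg
  have hφmk : ∀ g, φ (Submodule.Quotient.mk g) = Submodule.Quotient.mk (g * f) := fun _ => rfl
  have hψmk : ∀ g, ψ (Submodule.Quotient.mk g) = Submodule.Quotient.mk g := fun _ => rfl
  have hφ : Function.Injective φ := by
    rw [← LinearMap.ker_eq_bot, LinearMap.ker_eq_bot']
    intro x hx
    obtain ⟨g, rfl⟩ := Submodule.Quotient.mk_surjective _ x
    rw [hφmk, Submodule.Quotient.mk_eq_zero] at hx
    exact (Submodule.Quotient.mk_eq_zero _).mpr ((hJ g).mpr hx)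
  have hψ : Function.Surjective ψ := by
    intro x
    obtain ⟨g, rfl⟩ := Submodule.Quotient.mk_surjective _ x
    exact ⟨Submodule.Quotient.mk g, hψmk g⟩
  have hexact : Function.Exact φ ψ := by
    intro x
    obtain ⟨g, rfl⟩ := Submodule.Quotient.mk_surjective _ x
    rw [hψmk, Submodule.Quotient.mk_eq_zero]
    constructor
    · intro hg
      obtain ⟨a, ha, b, hb, hab⟩ := Submodule.mem_sup.mp hg
      obtain ⟨c, rfl⟩ := Ideal.mem_span_singleton'.mp hb
      refine ⟨Submodule.Quotient.mk c, ?_⟩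
      rw [hφmk]
      refine (Submodule.Quotient.eq _).mpr ?_
      have hab' : a + c * f = g := hab
      rw [← hab']
      simpa using ha
    · rintro ⟨y, hy⟩
      obtain ⟨c, rfl⟩ := Submodule.Quotient.mk_surjective _ y
      rw [hφmk] at hy
      have h := (Submodule.Quotient.eq _).mp hy
      rw [← sub_sub_cancel (c * f) g]
      exact sub_mem (Ideal.mem_sup_right (Ideal.mul_mem_left _ _ (Ideal.mem_span_singleton_self f)))
        (Ideal.mem_sup_left h)
  let C : ShortComplex (ModuleCat (MvPolynomial (Fin n) K)) :=
    ModuleCat.shortComplexOfCompEqZero φ ψ hexact.linearMap_comp_eq_zero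
  have hC : C.ShortExact := ModuleCat.shortComplex_shortExact C hexact hφ hψ
  have zero1 := AddCommGrpCat.isZero_of_iff_subsingleton.mpr (hI i hi)
  have zero2 := AddCommGrpCat.isZero_of_iff_subsingleton.mpr (hcolon (i + 1) (by omega))
  exact AddCommGrpCat.subsingleton_of_isZero <| ShortComplex.Exact.isZero_of_both_zeros
    ((Ext.covariant_sequence_exact₃' _ hC) i (i + 1) rfl)
    (zero1.eq_zero_of_src _) (zero2.eq_zero_of_tgt _)

theorem span_range_X_ne_top (K : Type*) [Field K] (σ : Type*) :
    Ideal.span (Set.range (X : σ → MvPolynomial σ K)) ≠ ⊤ := by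
  rw [← Set.image_univ]
  exact (isPrime_span_X_image K Set.univ).ne_top

open CategoryTheory Abelian Pointwise in
/-- Vanishing of `Ext` against `S ⧸ (x₁, …, xₙ)` yields homogeneous regular sequences. -/
theorem exists_isRegular_isHomogeneous {K : Type} [Field K] {n : ℕ} (d : ℕ)
    (M : ModuleCat.{0} (MvPolynomial (Fin n) K)) [Module.Finite (MvPolynomial (Fin n) K) M]
    (hM : Ideal.span (Set.range (X : Fin n → MvPolynomial (Fin n) K)) •
      (⊤ : Submodule (MvPolynomial (Fin n) K) M) ≠ ⊤)
    (hn : d = 0 ∨ 0 < n)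
    (hExt : ∀ i < d, Subsingleton (Ext
      (ModuleCat.of (MvPolynomial (Fin n) K) (MvPolynomial (Fin n) K ⧸
        Ideal.span (Set.range (X : Fin n → MvPolynomial (Fin n) K)))) M i)) :
    ∃ rs : List (MvPolynomial (Fin n) K), rs.length = d ∧
      (∀ f ∈ rs, (∃ e : ℕ, f.IsHomogeneous e) ∧
        f ∈ Ideal.span (Set.range (X : Fin n → MvPolynomial (Fin n) K))) ∧
      RingTheory.Sequence.IsRegular M rs := by
  induction d generalizing M with
  | zero =>
    have : Nontrivial M := (Submodule.nontrivial_iff (MvPolynomial (Fin n) K)).mp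
      (nontrivial_of_ne _ _ hM)
    exact ⟨[], rfl, by simp, RingTheory.Sequence.IsRegular.nil _ _⟩
  | succ d ih =>
    set 𝔪 := Ideal.span (Set.range (X : Fin n → MvPolynomial (Fin n) K)) with h𝔪
    have hn' : 0 < n := by omega
    have h0 : Subsingleton ((ModuleCat.of (MvPolynomial (Fin n) K)
        (MvPolynomial (Fin n) K ⧸ 𝔪)) ⟶ M) :=
      Ext.addEquiv₀.subsingleton_congr.mp (hExt 0 d.zero_lt_succ)
    have h1 : Subsingleton ((MvPolynomial (Fin n) K ⧸ 𝔪) →ₗ[MvPolynomial (Fin n) K] M) :=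
      (ModuleCat.homAddEquiv
        (M := ModuleCat.of _ (MvPolynomial (Fin n) K ⧸ 𝔪)) (N := M)).symm.subsingleton
    obtain ⟨x, hxann, hx⟩ := IsSMulRegular.subsingleton_linearMap_iff.mp h1
    rw [Ideal.annihilator_quotient] at hxann
    have hfin := associatedPrimes.finite (MvPolynomial (Fin n) K) M
    have hunion := biUnion_associatedPrimes_eq_compl_regular (M := M) (MvPolynomial (Fin n) K)
    obtain ⟨f, hfm, e, he, hfe, hf⟩ := exists_isHomogeneous_forall_notMem hfin.toFinset
      (fun P hP => (hfin.mem_toFinset.mp hP).isPrime) (fun P hP => by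
        by_contra! hall
        have hxP : x ∈ P := (Ideal.span_le.mpr (by rintro _ ⟨i, rfl⟩; exact hall i)) hxann
        have : x ∈ ⋃ p ∈ associatedPrimes (MvPolynomial (Fin n) K) M, (p : Set _) :=
          Set.mem_biUnion (hfin.mem_toFinset.mp hP) hxP
        rw [hunion] at this
        exact this hx) ⟨⟨0, hn'⟩⟩
    have hfreg : IsSMulRegular M f := by
      by_contra hcon
      have : f ∈ ⋃ p ∈ associatedPrimes (MvPolynomial (Fin n) K) M, (p : Set _) := by
        rw [hunion]; exact hcon
      obtain ⟨P, hP, hfP⟩ := Set.mem_iUnion₂.mp this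
      exact hf P (hfin.mem_toFinset.mpr hP) hfP
    have hExt' : ∀ i < d, Subsingleton (Ext
      (ModuleCat.of (MvPolynomial (Fin n) K) (MvPolynomial (Fin n) K ⧸ 𝔪))
      (ModuleCat.of (MvPolynomial (Fin n) K) (QuotSMulTop f M)) i) := by
      intro i hi
      have zero1 := AddCommGrpCat.isZero_of_iff_subsingleton.mpr (hExt i (by omega))
      have zero2 := AddCommGrpCat.isZero_of_iff_subsingleton.mpr (hExt (i + 1) (by omega))
      exact AddCommGrpCat.subsingleton_of_isZero <| ShortComplex.Exact.isZero_of_both_zeros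
        ((Ext.covariant_sequence_exact₃' _ hfreg.smulShortComplex_shortExact) i (i + 1) rfl)
        (zero1.eq_zero_of_src _) (zero2.eq_zero_of_tgt _)
    have hM' : 𝔪 • (⊤ : Submodule (MvPolynomial (Fin n) K) (QuotSMulTop f M)) ≠ ⊤ := by
      intro eq
      refine hM ?_
      have := congrArg (Submodule.comap (Submodule.mkQ _)) eq
      simpa [Submodule.comap_smul_top_of_surjective 𝔪 _ (Submodule.mkQ_surjective _),
        Submodule.smul_mono_left ((Ideal.span_singleton_le_iff_mem 𝔪).mpr hfm),
        ← Submodule.ideal_span_singleton_smul] using this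
    obtain ⟨rs, hlen, hmem, hreg⟩ := ih (ModuleCat.of _ (QuotSMulTop f M)) hM' (Or.inr hn') hExt'
    refine ⟨f :: rs, by simp [hlen], ?_, (RingTheory.Sequence.isRegular_cons_iff _ _ _).mpr
      ⟨hfreg, hreg⟩⟩
    rintro g hg
    rcases List.mem_cons.mp hg with rfl | hg
    · exact ⟨⟨e, hfe⟩, hfm⟩
    · exact hmem g hg

/-- The squarefree exponent vector of `s`, whose variables are 1-indexed. -/
noncomputable def sqfreeExponent (n : ℕ) (s : Finset ℕ) : Fin n →₀ ℕ :=
  Finsupp.equivFunOnFinite.symm fun i => if (i : ℕ) + 1 ∈ s then 1 else 0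

theorem sqfreeExponent_apply (n : ℕ) (s : Finset ℕ) (i : Fin n) :
    sqfreeExponent n s i = if (i : ℕ) + 1 ∈ s then 1 else 0 := rfl

/-- The squarefree monomial `∏_{t ∈ s} x_t`, whose variables are 1-indexed. -/
noncomputable def sqfreeMonomial (K : Type*) [Field K] (n : ℕ) (s : Finset ℕ) :
    MvPolynomial (Fin n) K :=
  monomial (sqfreeExponent n s) 1

/-- The ideal generated by the squarefree monomials with supports in `T`. -/
noncomputable def sqfreeIdeal (K : Type*) [Field K] (n : ℕ) (T : Set (Finset ℕ)) :
    Ideal (MvPolynomial (Fin n) K) :=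
  Ideal.span (sqfreeMonomial K n '' T)

theorem sqfreeMonomial_eq_prod (K : Type*) [Field K] (n : ℕ) (s : Finset ℕ) :
    sqfreeMonomial K n s = ∏ i ∈ Finset.univ.filter (fun i : Fin n => (i : ℕ) + 1 ∈ s), X i := by
  have h : sqfreeExponent n s =
      ∑ i ∈ Finset.univ.filter (fun i : Fin n => (i : ℕ) + 1 ∈ s),
        (Finsupp.single i 1 : Fin n →₀ ℕ) := by
    ext i
    simp [sqfreeExponent_apply, Finsupp.finsetSum_apply, Finsupp.single_apply]
  rw [sqfreeMonomial, h, monomial_sum_one]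
  rfl

theorem mem_sqfreeIdeal {K : Type*} [Field K] {n : ℕ} {T : Set (Finset ℕ)}
    {g : MvPolynomial (Fin n) K} : g ∈ sqfreeIdeal K n T ↔
      ∀ d ∈ g.support, ∃ t ∈ T, ∀ i : Fin n, (i : ℕ) + 1 ∈ t → d i ≠ 0 := by
  have h : sqfreeIdeal K n T =
      Ideal.span ((fun s => monomial s (1 : K)) '' (sqfreeExponent n '' T)) := by
    rw [Set.image_image]; rfl
  rw [h, mem_ideal_span_monomial_image]
  refine forall₂_congr fun d _ => ?_
  rw [Set.exists_mem_image]
  refine exists_congr fun t => and_congr_right fun _ => ?_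
  rw [Finsupp.le_def]
  refine forall_congr' fun i => ?_
  rw [sqfreeExponent_apply]
  split_ifs with hi <;> simp [hi, Nat.one_le_iff_ne_zero]

theorem sqfreeIdeal_mono {K : Type*} [Field K] {n : ℕ} {T T' : Set (Finset ℕ)}
    (h : ∀ t ∈ T, ∃ t' ∈ T', t' ⊆ t) : sqfreeIdeal K n T ≤ sqfreeIdeal K n T' := by
  intro g hg
  rw [mem_sqfreeIdeal] at hg ⊢
  intro d hd
  obtain ⟨t, ht, htd⟩ := hg d hd
  obtain ⟨t', ht', hsub⟩ := h t ht
  exact ⟨t', ht', fun i hi => htd i (hsub hi)⟩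

theorem sqfreeIdeal_insert (K : Type*) [Field K] (n : ℕ) (s : Finset ℕ) (T : Set (Finset ℕ)) :
    sqfreeIdeal K n (insert s T) = sqfreeIdeal K n T ⊔ Ideal.span {sqfreeMonomial K n s} := by
  rw [sqfreeIdeal, Set.image_insert_eq, Ideal.span_insert, sup_comm, sqfreeIdeal]

theorem mul_sqfreeMonomial_mem_sqfreeIdeal_iff {K : Type*} [Field K] {n : ℕ} {s : Finset ℕ}
    {T T' : Set (Finset ℕ)} (h : ∀ t ∈ T, ∃ t' ∈ T', t' ⊆ t \ s)
    (h' : ∀ t' ∈ T', ∃ t ∈ T, t \ s ⊆ t') (g : MvPolynomial (Fin n) K) :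
    g ∈ sqfreeIdeal K n T' ↔ g * sqfreeMonomial K n s ∈ sqfreeIdeal K n T := by
  rw [mem_sqfreeIdeal, mem_sqfreeIdeal, sqfreeMonomial]
  constructor
  · intro hg d hd
    rw [mem_support_iff, coeff_mul_monomial'] at hd
    split_ifs at hd with hle
    · rw [mul_one, ← mem_support_iff] at hd
      obtain ⟨t', ht', hd'⟩ := hg _ hd
      obtain ⟨t, ht, hsub⟩ := h' t' ht'
      refine ⟨t, ht, fun i hi => ?_⟩
      by_cases his : (i : ℕ) + 1 ∈ s
      · have := hle i
        rw [sqfreeExponent_apply, if_pos his] at this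
        omega
      · have := hd' i (hsub (Finset.mem_sdiff.mpr ⟨hi, his⟩))
        rw [Finsupp.tsub_apply] at this
        omega
    · exact absurd rfl hd
  · intro hg d hd
    obtain ⟨t, ht, hd'⟩ := hg (d + sqfreeExponent n s) (by
      rw [mem_support_iff, coeff_mul_monomial, mul_one]
      exact mem_support_iff.mp hd)
    obtain ⟨t', ht', hsub⟩ := h t ht
    refine ⟨t', ht', fun i hi => ?_⟩
    obtain ⟨hit, his⟩ := Finset.mem_sdiff.mp (hsub hi)
    have := hd' i hit
    rwa [Finsupp.add_apply, sqfreeExponent_apply, if_neg his, add_zero] at this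

theorem HasCodepthLE.sqfreeIdeal_insert {K : Type} [Field K] {n r : ℕ} {s : Finset ℕ}
    {T T' : Set (Finset ℕ)} (h : ∀ t ∈ T, ∃ t' ∈ T', t' ⊆ t \ s)
    (h' : ∀ t' ∈ T', ∃ t ∈ T, t \ s ⊆ t') (hT : HasCodepthLE (sqfreeIdeal K n T) (r + 1))
    (hT' : HasCodepthLE (sqfreeIdeal K n T') r) :
    HasCodepthLE (sqfreeIdeal K n (insert s T)) (r + 1) := by
  rw [_root_.sqfreeIdeal_insert]
  exact hT.sup_span_singleton (mul_sqfreeMonomial_mem_sqfreeIdeal_iff h h') hT'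

theorem xv_eq_sqfreeMonomial (K : Type) [Field K] {n t : ℕ} (h1 : 1 ≤ t) (hn : t ≤ n) :
    xv K n t = sqfreeMonomial K n {t} := by
  have h : (Finset.univ.filter fun i : Fin n => (i : ℕ) + 1 ∈ ({t} : Finset ℕ)) =
      {⟨t - 1, by omega⟩} := by
    ext i
    simp only [Finset.mem_filter, Finset.mem_univ, true_and, Finset.mem_singleton, Fin.ext_iff]
    omega
  rw [sqfreeMonomial_eq_prod, h, Finset.prod_singleton, xv, dif_pos ⟨h1, hn⟩]

theorem pathGen_eq_sqfreeMonomial (K : Type) [Field K] (n m i : ℕ) :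
    pathGen K n m i = sqfreeMonomial K n (Finset.Ico i (i + m)) := by
  rw [sqfreeMonomial_eq_prod, pathGen]
  simp only [Finset.mem_Ico]

theorem prod_xv_eq_sqfreeMonomial (K : Type) [Field K] {n : ℕ} (s : Finset ℕ) {f : ℕ → ℕ}
    (hf : Set.InjOn f s) (h1 : ∀ l ∈ s, 1 ≤ f l) (hn : ∀ l ∈ s, f l ≤ n) :
    ∏ l ∈ s, xv K n (f l) = sqfreeMonomial K n (s.image f) := by
  have h : ∀ l (hl : l ∈ s), f l - 1 < n := fun l hl => by
    have := h1 l hl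
    have := hn l hl
    omega
  rw [sqfreeMonomial_eq_prod]
  refine Finset.prod_bij (fun l hl => ⟨f l - 1, h l hl⟩) ?_ ?_ ?_ ?_
  · intro l hl
    simp only [Finset.mem_filter, Finset.mem_univ, true_and, Nat.sub_add_cancel (h1 l hl)]
    exact Finset.mem_image_of_mem f hl
  · intro l hl l' hl' heq
    rw [Fin.mk.injEq] at heq
    have := h1 l hl
    have := h1 l' hl'
    exact hf hl hl' (by omega)
  · intro i hi
    obtain ⟨l, hl, hli⟩ := Finset.mem_image.mp (Finset.mem_filter.mp hi).2
    exact ⟨l, hl, Fin.ext (by simp [hli])⟩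
  · intro l hl
    rw [xv, dif_pos ⟨h1 l hl, hn l hl⟩]

theorem isRegular_ofFn_X (K : Type*) [Field K] (n : ℕ) :
    RingTheory.Sequence.IsRegular (MvPolynomial (Fin n) K)
      (List.ofFn (X : Fin n → MvPolynomial (Fin n) K)) := by
  have hle : Ideal.ofList (List.ofFn (X : Fin n → MvPolynomial (Fin n) K)) =
      Ideal.span (Set.range X) := by
    rw [Ideal.ofList]
    congr 1
    ext f
    simp [List.mem_ofFn]
  refine ⟨(RingTheory.Sequence.isWeaklyRegular_iff _ _).mpr fun i hi => ?_, ?_⟩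
  · have hin : i < n := by simpa using hi
    have htake : Ideal.ofList ((List.ofFn (X : Fin n → MvPolynomial (Fin n) K)).take i) =
        Ideal.span (X '' {l : Fin n | (l : ℕ) < i}) := by
      rw [Ideal.ofList]
      congr 1
      ext f
      simp only [Set.mem_ofPred_eq, Set.mem_image, List.mem_take_iff_getElem, List.getElem_ofFn]
      constructor
      · rintro ⟨l, hl, rfl⟩
        exact ⟨⟨l, by simp at hl; omega⟩, by simp at hl; simp; omega, rfl⟩
      · rintro ⟨l, hl, rfl⟩
        exact ⟨l, by simp; omega, rfl⟩
    rw [htake, List.getElem_ofFn, isSMulRegular_quotient_iff_mem_of_smul_mem]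
    intro f hf
    rw [smul_eq_mul, Ideal.mul_top] at hf ⊢
    rw [smul_eq_mul] at hf
    refine ((isPrime_span_X_image K _).mem_or_mem hf).resolve_left fun hX => ?_
    rw [X_mem_span_X_image_iff] at hX
    simp at hX
  · rw [hle, smul_eq_mul, Ideal.mul_top]
    exact (span_range_X_ne_top K _).symm

theorem hasCodepthLE_sqfreeIdeal_empty (K : Type) [Field K] (n : ℕ) :
    HasCodepthLE (sqfreeIdeal K n ∅) 0 := by
  have hbot : sqfreeIdeal K n ∅ = ⊥ := by simp [sqfreeIdeal]
  let e := Submodule.quotEquivOfEqBot _ hbot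
  have hreg := (e.isRegular_congr _).mpr (isRegular_ofFn_X K n)
  intro i hi
  refine ModuleCat.subsingleton_ext_of_exists_isRegular
    (Ideal.span (Set.range (X : Fin n → MvPolynomial (Fin n) K))) _ ?_ _ ?_ _ ?_ hreg i ?_
  · rw [Module.support_eq_zeroLocus, Ideal.annihilator_quotient]
  · refine lt_top_iff_ne_top.mpr fun h => ?_
    have := Submodule.map_smul'' (Ideal.span (Set.range
      (X : Fin n → MvPolynomial (Fin n) K))) ⊤ e.toLinearMap
    have h' : Ideal.span (Set.range (X : Fin n → MvPolynomial (Fin n) K)) •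
      (⊤ : Submodule (MvPolynomial (Fin n) K)
        (MvPolynomial (Fin n) K ⧸ sqfreeIdeal K n ∅)) = ⊤ := h
    rw [h', Submodule.map_top, LinearEquiv.range, smul_eq_mul, Ideal.mul_top] at this
    exact span_range_X_ne_top K _ this.symm
  · intro f hf
    obtain ⟨l, rfl⟩ := (List.mem_ofFn' _ _).mp hf
    exact Ideal.subset_span ⟨l, rfl⟩
  · rw [List.length_ofFn]; omega

/-- The positions `e - m + 1, …, e` without those `x < p` with `x ≡ -1` modulo `m + 1`. -/
def prunedWindow (m p e : ℕ) : Finset ℕ :=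
  (Finset.Icc (e - m + 1) e).filter fun x => ¬ (x < p ∧ m + 1 ∣ x + 1)

theorem mem_prunedWindow {m p e x : ℕ} :
    x ∈ prunedWindow m p e ↔ (e - m + 1 ≤ x ∧ x ≤ e) ∧ (x < p → ¬ m + 1 ∣ x + 1) := by
  simp [prunedWindow]

/-- The supports of the generators of `U_j` that involve only the variables `x_1, …, x_e`,
together with `x_p` for `p = j (m + 1) - 1`. -/
def prunedWindows (m p e : ℕ) : Set (Finset ℕ) :=
  insert {p} {t | ∃ e', m ≤ e' ∧ e' ≤ e ∧ t = prunedWindow m p e'}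

theorem prunedWindows_of_lt {m p e : ℕ} (h : e < m) : prunedWindows m p e = {{p}} := by
  ext t
  simp only [prunedWindows, Set.mem_insert_iff, Set.mem_singleton_iff, Set.mem_ofPred_eq]
  constructor
  · rintro (rfl | ⟨e', h1, h2, -⟩)
    · rfl
    · omega
  · exact Or.inl

theorem prunedWindows_succ {m p e : ℕ} (h : m ≤ e + 1) :
    prunedWindows m p (e + 1) = insert (prunedWindow m p (e + 1)) (prunedWindows m p e) := by
  ext t
  simp only [prunedWindows, Set.mem_insert_iff, Set.mem_ofPred_eq]
  constructor
  · rintro (rfl | ⟨e', h1, h2, rfl⟩)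
    · exact Or.inr (Or.inl rfl)
    · rcases Nat.lt_or_ge e e' with h' | h'
      · obtain rfl : e' = e + 1 := by omega
        exact Or.inl rfl
      · exact Or.inr (Or.inr ⟨e', h1, h', rfl⟩)
  · rintro (rfl | rfl | ⟨e', h1, h2, rfl⟩)
    · exact Or.inr ⟨e + 1, h, le_rfl, rfl⟩
    · exact Or.inl rfl
    · exact Or.inr ⟨e', h1, by omega, rfl⟩

theorem singleton_mem_prunedWindows (m p e : ℕ) : {p} ∈ prunedWindows m p e :=
  Set.mem_insert _ _

theorem prunedWindow_mem_prunedWindows {m p e e' : ℕ} (h1 : m ≤ e') (h2 : e' ≤ e) :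
    prunedWindow m p e' ∈ prunedWindows m p e :=
  Or.inr ⟨e', h1, h2, rfl⟩

theorem forall_mem_prunedWindows {m p e : ℕ} {q : Finset ℕ → Prop} (hp : q {p})
    (h : ∀ e', m ≤ e' → e' ≤ e → q (prunedWindow m p e')) : ∀ t ∈ prunedWindows m p e, q t := by
  rintro t (rfl | ⟨e', h1, h2, rfl⟩)
  · exact hp
  · exact h e' h1 h2

theorem hasCodepthLE_sqfreeIdeal_singleton (K : Type) [Field K] (n : ℕ) (s : Finset ℕ) :
    HasCodepthLE (sqfreeIdeal K n {s}) 1 := by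
  rw [← insert_empty_eq]
  exact HasCodepthLE.sqfreeIdeal_insert (T' := ∅) (by simp) (by simp)
    ((hasCodepthLE_sqfreeIdeal_empty K n).mono (Nat.zero_le _))
    (hasCodepthLE_sqfreeIdeal_empty K n)

theorem hasCodepthLE_prunedWindows_of_redundant {K : Type} [Field K] {n m p e r : ℕ}
    (he : m ≤ e + 1) (h : (p ≤ e + 1 ∧ e + 1 < p + m) ∨ (m ≤ e ∧ e + 1 < p ∧ m + 1 ∣ e + 3))
    (hr : HasCodepthLE (sqfreeIdeal K n (prunedWindows m p e)) r) :
    HasCodepthLE (sqfreeIdeal K n (prunedWindows m p (e + 1))) r := by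
  have heq : sqfreeIdeal K n (prunedWindows m p (e + 1)) =
      sqfreeIdeal K n (prunedWindows m p e) := by
    rw [prunedWindows_succ he]
    refine le_antisymm (sqfreeIdeal_mono ?_) (sqfreeIdeal_mono fun t ht => ⟨t, Or.inr ht, le_rfl⟩)
    rintro t (rfl | ht)
    · rcases h with h | ⟨h1, h2, h3⟩
      · refine ⟨_, singleton_mem_prunedWindows _ _ _, ?_⟩
        rw [Finset.singleton_subset_iff, mem_prunedWindow]
        omega
      · refine ⟨_, prunedWindow_mem_prunedWindows h1 le_rfl, fun x hx => ?_⟩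
        rw [mem_prunedWindow] at hx ⊢
        refine ⟨⟨?_, by omega⟩, hx.2⟩
        rcases Nat.lt_or_ge (e - m + 1) x with h4 | h4
        · omega
        · obtain rfl : x = e - m + 1 := by omega
          refine absurd ?_ (hx.2 (by omega))
          have := Nat.dvd_sub h3 (dvd_refl (m + 1))
          rwa [show e + 3 - (m + 1) = e - m + 1 + 1 by omega] at this
    · exact ⟨t, ht, le_rfl⟩
  rwa [heq]

theorem hasCodepthLE_prunedWindows_self {K : Type} [Field K] {n m p r : ℕ} (hm : 1 ≤ m)
    (hp : m < p) (hr : HasCodepthLE (sqfreeIdeal K n (prunedWindows m p (m - 1))) (r + 1))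
    (h1 : 1 ≤ r) : HasCodepthLE (sqfreeIdeal K n (prunedWindows m p m)) (r + 1) := by
  obtain ⟨m, rfl⟩ : ∃ m', m = m' + 1 := ⟨m - 1, by omega⟩
  rw [prunedWindows_succ le_rfl]
  rw [Nat.add_sub_cancel] at hr
  have hdisj : {p} \ prunedWindow (m + 1) p (m + 1) = {p} := by
    rw [sdiff_eq_left, Finset.disjoint_singleton_left, mem_prunedWindow]
    omega
  rw [prunedWindows_of_lt (by omega)] at hr ⊢
  refine HasCodepthLE.sqfreeIdeal_insert (T' := {{p}}) ?_ ?_ hr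
    ((hasCodepthLE_sqfreeIdeal_singleton K n _).mono h1) <;>
  · rintro t rfl
    exact ⟨{p}, rfl, by rw [hdisj]⟩

theorem hasCodepthLE_prunedWindows_step {K : Type} [Field K] {n m p e r : ℕ} (hm : 1 ≤ m)
    (he : m ≤ e) (h : ¬ ((p ≤ e + 1 ∧ e + 1 < p + m) ∨ (e + 1 < p ∧ m + 1 ∣ e + 3)))
    (hr : HasCodepthLE (sqfreeIdeal K n (prunedWindows m p e)) (r + 1))
    (hr' : HasCodepthLE (sqfreeIdeal K n (insert {e - m + 1} (prunedWindows m p (e - m)))) r) :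
    HasCodepthLE (sqfreeIdeal K n (prunedWindows m p (e + 1))) (r + 1) := by
  have hnd : e - m + 1 < p → ¬ m + 1 ∣ e - m + 1 + 1 := by
    intro h1 h2
    refine h (Or.inr ⟨?_, ?_⟩)
    · by_contra h3
      refine h (Or.inl ⟨by omega, by omega⟩)
    · have := Nat.dvd_add h2 (dvd_refl (m + 1))
      rwa [show e - m + 1 + 1 + (m + 1) = e + 3 by omega] at this
  have hdisj : {p} \ prunedWindow m p (e + 1) = {p} := by
    rw [sdiff_eq_left, Finset.disjoint_singleton_left, mem_prunedWindow]
    omega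
  have hdisj' : ∀ e' ≤ e - m,
      prunedWindow m p e' \ prunedWindow m p (e + 1) = prunedWindow m p e' := by
    intro e' he'
    rw [sdiff_eq_left, Finset.disjoint_left]
    intro x hx hx'
    rw [mem_prunedWindow] at hx hx'
    omega
  rw [prunedWindows_succ (by omega)]
  refine HasCodepthLE.sqfreeIdeal_insert
    (T' := insert {e - m + 1} (prunedWindows m p (e - m))) ?_ ?_ hr hr'
  · refine forall_mem_prunedWindows ⟨_, Or.inr (singleton_mem_prunedWindows _ _ _), hdisj.ge⟩ ?_
    intro e' h1 h2
    rcases Nat.lt_or_ge (e - m) e' with h3 | h3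
    · refine ⟨_, Or.inl rfl, ?_⟩
      rw [Finset.singleton_subset_iff, Finset.mem_sdiff, mem_prunedWindow, mem_prunedWindow]
      exact ⟨⟨by omega, hnd⟩, by omega⟩
    · exact ⟨_, Or.inr (prunedWindow_mem_prunedWindows h1 h3), (hdisj' e' h3).ge⟩
  · rintro t (rfl | ht)
    · refine ⟨_, prunedWindow_mem_prunedWindows he le_rfl, fun x hx => ?_⟩
      rw [Finset.mem_sdiff, mem_prunedWindow, mem_prunedWindow] at hx
      rw [Finset.mem_singleton]
      by_contra hne
      exact hx.2 ⟨by omega, hx.1.2⟩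
    · revert t
      refine forall_mem_prunedWindows ⟨_, singleton_mem_prunedWindows _ _ _, hdisj.le⟩ ?_
      intro e' h1 h2
      exact ⟨_, prunedWindow_mem_prunedWindows h1 (by omega), (hdisj' e' h2).le⟩

theorem hasCodepthLE_insert_prunedWindows {K : Type} [Field K] {n m p e r : ℕ}
    (h : HasCodepthLE (sqfreeIdeal K n (prunedWindows m p e)) r) :
    HasCodepthLE (sqfreeIdeal K n (insert {e + 1} (prunedWindows m p e))) (r + 1) := by
  by_cases hp : e + 1 = p
  · rw [hp, Set.insert_eq_of_mem (singleton_mem_prunedWindows _ _ _)]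
    exact h.mono (Nat.le_succ r)
  · have hdisj : ∀ t ∈ prunedWindows m p e, t \ {e + 1} = t := by
      refine forall_mem_prunedWindows ?_ fun e' h1 h2 => ?_
      · rw [sdiff_eq_left, Finset.disjoint_singleton]
        exact Ne.symm hp
      · rw [sdiff_eq_left, Finset.disjoint_singleton_right, mem_prunedWindow]
        omega
    exact HasCodepthLE.sqfreeIdeal_insert (fun t ht => ⟨t, ht, (hdisj t ht).ge⟩)
      (fun t ht => ⟨t, ht, (hdisj t ht).le⟩) (h.mono (Nat.le_succ r)) h

/-- The codepth bound for the ideal generated by the monomials of `prunedWindows m p e`. -/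
def codepthBound (m p e : ℕ) : ℕ :=
  if e < p then 2 * ((e + 1) / (m + 1)) + 1
  else 2 * ((e + 1) / (m + 1)) - 1 + if (e + 1) % (m + 1) = m then 1 else 0

theorem codepthBound_eq {m p j : ℕ} (hmp : p + 1 = j * (m + 1)) (e : ℕ) :
    codepthBound m p e = if (e + 1) / (m + 1) < j then 2 * ((e + 1) / (m + 1)) + 1
      else 2 * ((e + 1) / (m + 1)) - 1 + if (e + 1) % (m + 1) = m then 1 else 0 := by
  have h : (e + 1) / (m + 1) < j ↔ e < p := by
    rw [Nat.div_lt_iff_lt_mul m.succ_pos, ← hmp]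
    omega
  simp only [codepthBound, h]

theorem succ_div_mod_cases (x m : ℕ) :
    (x % (m + 1) = m ∧ (x + 1) / (m + 1) = x / (m + 1) + 1 ∧ (x + 1) % (m + 1) = 0) ∨
    (x % (m + 1) < m ∧ (x + 1) / (m + 1) = x / (m + 1) ∧ (x + 1) % (m + 1) = x % (m + 1) + 1) := by
  have h1 := Nat.div_add_mod x (m + 1)
  have h2 := Nat.mod_lt x m.succ_pos
  generalize x / (m + 1) = q at *
  generalize x % (m + 1) = r at *
  subst h1
  rcases Nat.lt_or_ge r m with h | h
  · refine Or.inr ⟨h, ?_, ?_⟩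
    · rw [add_assoc, Nat.mul_add_div m.succ_pos, Nat.div_eq_of_lt (by omega), add_zero]
    · rw [add_assoc, Nat.mul_add_mod, Nat.mod_eq_of_lt (by omega)]
  · obtain rfl : r = m := by omega
    refine Or.inl ⟨rfl, ?_, ?_⟩
    · rw [add_assoc, Nat.mul_add_div r.succ_pos, Nat.div_self r.succ_pos]
    · rw [add_assoc, Nat.mul_add_mod, Nat.mod_self]

theorem codepthBound_le_succ {m p j : ℕ} (hj : 1 ≤ j) (hmp : p + 1 = j * (m + 1)) (e : ℕ) :
    codepthBound m p e ≤ codepthBound m p (e + 1) := by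
  rw [codepthBound_eq hmp, codepthBound_eq hmp]
  have := succ_div_mod_cases (e + 1) m
  split_ifs <;> omega

theorem codepthBound_add_two_le {m p j e : ℕ} (hj : 1 ≤ j) (hmp : p + 1 = j * (m + 1)) (he : m ≤ e)
    (h : e + 1 < p ∨ p + m < e + 1) :
    codepthBound m p (e - m) + 2 ≤ codepthBound m p (e + 1) := by
  have h1 : e + 1 + 1 = e - m + 1 + (m + 1) := by omega
  have h2 : (e + 1 + 1) / (m + 1) = (e - m + 1) / (m + 1) + 1 := by
    rw [h1, Nat.add_div_right _ m.succ_pos]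
  have h3 : (e + 1 + 1) % (m + 1) = (e - m + 1) % (m + 1) := by
    rw [h1, Nat.add_mod_right]
  have h4 : (e - m + 1) / (m + 1) < j ↔ e - m + 1 < p + 1 := by
    rw [Nat.div_lt_iff_lt_mul m.succ_pos, ← hmp]
  have h5 : (e + 1 + 1) / (m + 1) < j ↔ e + 1 + 1 < p + 1 := by
    rw [Nat.div_lt_iff_lt_mul m.succ_pos, ← hmp]
  rw [codepthBound_eq hmp, codepthBound_eq hmp, h3]
  rw [h2] at h5 ⊢
  clear h1 h2 h3 hmp
  generalize (e - m + 1) / (m + 1) = q at *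
  generalize (e - m + 1) % (m + 1) = r at *
  split_ifs <;> omega

theorem one_le_codepthBound {m p j : ℕ} (hj : 1 ≤ j) (hmp : p + 1 = j * (m + 1)) (e : ℕ) :
    1 ≤ codepthBound m p e := by
  rw [codepthBound_eq hmp]
  split_ifs <;> omega

theorem hasCodepthLE_prunedWindows (K : Type) [Field K] (n : ℕ) {m p j : ℕ} (hm : 1 ≤ m)
    (hj : 1 ≤ j) (hmp : p + 1 = j * (m + 1)) (e : ℕ) :
    HasCodepthLE (sqfreeIdeal K n (prunedWindows m p e)) (codepthBound m p e) := by
  have hpm : m ≤ p := by nlinarith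
  induction e using Nat.strong_induction_on with
  | _ e ih =>
    rcases Nat.lt_or_ge e m with he | he
    · rw [prunedWindows_of_lt he]
      exact (hasCodepthLE_sqfreeIdeal_singleton K n _).mono (one_le_codepthBound hj hmp e)
    obtain ⟨e, rfl⟩ : ∃ e', e = e' + 1 := ⟨e - 1, by omega⟩
    have hr := (ih e e.lt_succ_self).mono (codepthBound_le_succ hj hmp e)
    by_cases hred : (p ≤ e + 1 ∧ e + 1 < p + m) ∨ (m ≤ e ∧ e + 1 < p ∧ m + 1 ∣ e + 3)
    · exact hasCodepthLE_prunedWindows_of_redundant he hred hr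
    obtain ⟨r, hR⟩ : ∃ r, codepthBound m p (e + 1) = r + 1 :=
      ⟨_, (Nat.sub_add_cancel (one_le_codepthBound hj hmp _)).symm⟩
    rw [hR] at hr ⊢
    rcases he.eq_or_lt with rfl | he
    · refine hasCodepthLE_prunedWindows_self hm (by omega) hr ?_
      rw [codepthBound, if_pos (by omega), Nat.div_self (Nat.succ_pos _)] at hR
      omega
    · have he : m ≤ e := by omega
      refine hasCodepthLE_prunedWindows_step hm he (by tauto) hr ?_
      by_cases hpe : e + 1 = p + m
      · have hp : p = e - m + 1 := by omega
        rw [← hp, Set.insert_eq_of_mem (singleton_mem_prunedWindows _ _ _)]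
        refine (ih (e - m) (by omega)).mono ?_
        obtain ⟨i, rfl⟩ : ∃ i, j = i + 1 := ⟨j - 1, by omega⟩
        have h1 : (e + 1 + 1) / (m + 1) = i + 1 := by
          rw [hpe, show p + m + 1 = (m + 1) * (i + 1) + m by linarith,
            Nat.mul_add_div m.succ_pos, Nat.div_eq_of_lt m.lt_succ_self, add_zero]
        have h2 : (e + 1 + 1) % (m + 1) = m := by
          rw [hpe, show p + m + 1 = (m + 1) * (i + 1) + m by linarith, Nat.mul_add_mod,
            Nat.mod_eq_of_lt m.lt_succ_self]
        have h3 : (e - m + 1) / (m + 1) < i + 1 := by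
          rw [Nat.div_lt_iff_lt_mul m.succ_pos, ← hmp]
          omega
        rw [codepthBound_eq hmp, h1, h2] at hR
        rw [codepthBound_eq hmp, if_pos h3]
        simp only [lt_irrefl, if_true, if_false] at hR
        omega
      · refine (hasCodepthLE_insert_prunedWindows (ih (e - m) (by omega))).mono ?_
        have := codepthBound_add_two_le hj hmp he (by omega)
        omega

theorem pathIdeal_eq_sqfreeIdeal (K : Type) [Field K] {n m : ℕ} (hm : 1 ≤ m) (hn : m ≤ n) :
    pathIdeal K n m =
      sqfreeIdeal K n {t | ∃ e, m ≤ e ∧ e ≤ n ∧ t = Finset.Icc (e - m + 1) e} := by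
  rw [pathIdeal, sqfreeIdeal]
  congr 1
  ext f
  simp only [Set.mem_image, Set.mem_ofPred_eq]
  have h : ∀ i, Finset.Ico i (i + m) = Finset.Icc (i + m - 1 - m + 1) (i + m - 1) ∨ i = 0 := by
    intro i
    rcases Nat.eq_zero_or_pos i with hi | hi
    · exact Or.inr hi
    · left
      ext x
      rw [Finset.mem_Ico, Finset.mem_Icc]
      omega
  constructor
  · rintro ⟨i, h1, h2, rfl⟩
    refine ⟨_, ⟨i + m - 1, by omega, by omega, rfl⟩, ?_⟩
    rw [pathGen_eq_sqfreeMonomial, (h i).resolve_right (by omega)]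
  · rintro ⟨_, ⟨e, h1, h2, rfl⟩, rfl⟩
    refine ⟨e - m + 1, by omega, by omega, ?_⟩
    rw [pathGen_eq_sqfreeMonomial, (h _).resolve_right (by omega)]
    congr 2 <;> omega

theorem colon_sup_eq_sqfreeIdeal (K : Type) [Field K] {n m j : ℕ} (hm : 1 ≤ m) (hj : 1 ≤ j)
    (hn : j * (m + 1) - 1 ≤ n) :
    (pathIdeal K n m).colon
        (Ideal.span {∏ l ∈ Finset.Icc 1 (j - 1), xv K n (l * (m + 1) - 1)}) +
      Ideal.span {xv K n (j * (m + 1) - 1)} =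
    sqfreeIdeal K n (prunedWindows m (j * (m + 1) - 1) n) := by
  have hjm : m + 1 ≤ j * (m + 1) := Nat.le_mul_of_pos_left _ hj
  have hle : ∀ l ∈ Finset.Icc 1 (j - 1), m + 1 ≤ l * (m + 1) ∧ l * (m + 1) < j * (m + 1) := by
    intro l hl
    rw [Finset.mem_Icc] at hl
    exact ⟨Nat.le_mul_of_pos_left _ hl.1, Nat.mul_lt_mul_of_pos_right (by omega) m.succ_pos⟩
  have hprod := prod_xv_eq_sqfreeMonomial K (n := n) (Finset.Icc 1 (j - 1))
    (f := fun l => l * (m + 1) - 1)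
    (fun l hl l' hl' h => by
      have h1 := hle l hl
      have h2 := hle l' hl'
      have h3 : l * (m + 1) = l' * (m + 1) := by dsimp only at h; omega
      exact Nat.eq_of_mul_eq_mul_right m.succ_pos h3)
    (fun l hl => by have := hle l hl; omega) (fun l hl => by have := hle l hl; omega)
  have hsdiff : ∀ e, Finset.Icc (e - m + 1) e \
      (Finset.Icc 1 (j - 1)).image (fun l => l * (m + 1) - 1) =
      prunedWindow m (j * (m + 1) - 1) e := by
    intro e
    ext x
    rw [Finset.mem_sdiff, mem_prunedWindow, Finset.mem_Icc, Finset.mem_image]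
    refine and_congr_right fun hx => ?_
    constructor
    · rintro h hlt ⟨l, hl⟩
      refine h ⟨l, Finset.mem_Icc.mpr ⟨?_, ?_⟩, ?_⟩
      · rcases Nat.eq_zero_or_pos l with rfl | hl'
        · omega
        · exact hl'
      · have : (m + 1) * l < (m + 1) * j := by rw [← hl, mul_comm (m + 1)]; omega
        have := Nat.lt_of_mul_lt_mul_left this
        omega
      · rw [mul_comm, ← hl]; omega
    · rintro h ⟨l, hl, rfl⟩
      have := hle l hl
      exact h (by omega) ⟨l, by rw [mul_comm (m + 1)]; omega⟩
  rw [hprod, xv_eq_sqfreeMonomial K (by omega) hn, prunedWindows, sqfreeIdeal_insert,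
    Submodule.add_eq_sup]
  congr 1
  ext g
  rw [Ideal.mem_colon_span_singleton, pathIdeal_eq_sqfreeIdeal K hm (by omega)]
  refine (mul_sqfreeMonomial_mem_sqfreeIdeal_iff ?_ ?_ g).symm
  · rintro _ ⟨e, h1, h2, rfl⟩
    exact ⟨_, ⟨e, h1, h2, rfl⟩, (hsdiff e).ge⟩
  · rintro _ ⟨e, h1, h2, rfl⟩
    exact ⟨_, ⟨e, h1, h2, rfl⟩, (hsdiff e).le⟩

/-- The complement of a facet of the simplicial complex of `U_j` in the case
`n = k (m + 1) - 1 + a`. -/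
def facetComplement (m a k j : ℕ) : Finset ℕ :=
  (Finset.Icc 1 (k - 1)).image
    (fun l => if l < j then l * (m + 1) - 2 else l * (m + 1) + a) ∪
  (Finset.Icc 1 k).image (fun l => if l < j then l * (m + 1) else l * (m + 1) - 1)

theorem add_le_mul_of_lt {l l' : ℕ} (m : ℕ) (h : l < l') :
    l * (m + 1) + (m + 1) ≤ l' * (m + 1) := by
  rw [← Nat.succ_mul]
  exact Nat.mul_le_mul_right _ h

theorem mem_facetComplement {m a k j x : ℕ} (hjk : j + 1 ≤ k) : x ∈ facetComplement m a k j ↔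
    ∃ l, 1 ≤ l ∧ l ≤ k ∧ (l < j ∧ (x = l * (m + 1) - 2 ∨ x = l * (m + 1)) ∨
      j ≤ l ∧ (x = l * (m + 1) - 1 ∨ l < k ∧ x = l * (m + 1) + a)) := by
  rw [facetComplement, Finset.mem_union, Finset.mem_image, Finset.mem_image]
  constructor
  · rintro (⟨l, hl, rfl⟩ | ⟨l, hl, rfl⟩) <;> rw [Finset.mem_Icc] at hl <;>
      refine ⟨l, by omega, by omega, ?_⟩ <;> split_ifs <;> omega
  · rintro ⟨l, h1, h2, ⟨h3, rfl | rfl⟩ | ⟨h3, rfl | ⟨h4, rfl⟩⟩⟩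
    · exact Or.inl ⟨l, Finset.mem_Icc.mpr (by omega), if_pos h3⟩
    · exact Or.inr ⟨l, Finset.mem_Icc.mpr (by omega), if_pos h3⟩
    · exact Or.inr ⟨l, Finset.mem_Icc.mpr (by omega), if_neg (by omega)⟩
    · exact Or.inl ⟨l, Finset.mem_Icc.mpr (by omega), if_neg (by omega)⟩

theorem card_facetComplement {m a k j : ℕ} (ha : a + 1 < m) (hjk : j + 1 ≤ k) :
    (facetComplement m a k j).card = 2 * k - 1 := by
  rw [facetComplement, Finset.card_union_of_disjoint, Finset.card_image_of_injOn,
    Finset.card_image_of_injOn, Nat.card_Icc, Nat.card_Icc]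
  · omega
  · intro l hl l' hl' h
    rw [Finset.mem_coe, Finset.mem_Icc] at hl hl'
    have h1 : m + 1 ≤ l * (m + 1) := Nat.le_mul_of_pos_left _ hl.1
    have h2 : m + 1 ≤ l' * (m + 1) := Nat.le_mul_of_pos_left _ hl'.1
    dsimp only at h
    rcases lt_trichotomy l l' with hlt | rfl | hlt
    · have := add_le_mul_of_lt m hlt
      split_ifs at h <;> omega
    · rfl
    · have := add_le_mul_of_lt m hlt
      split_ifs at h <;> omega
  · intro l hl l' hl' h
    rw [Finset.mem_coe, Finset.mem_Icc] at hl hl'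
    have h1 : m + 1 ≤ l * (m + 1) := Nat.le_mul_of_pos_left _ hl.1
    have h2 : m + 1 ≤ l' * (m + 1) := Nat.le_mul_of_pos_left _ hl'.1
    dsimp only at h
    rcases lt_trichotomy l l' with hlt | rfl | hlt
    · have := add_le_mul_of_lt m hlt
      split_ifs at h <;> omega
    · rfl
    · have := add_le_mul_of_lt m hlt
      split_ifs at h <;> omega
  · rw [Finset.disjoint_left]
    intro x hx hx'
    obtain ⟨l, hl, rfl⟩ := Finset.mem_image.mp hx
    obtain ⟨l', hl', h⟩ := Finset.mem_image.mp hx'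
    rw [Finset.mem_Icc] at hl hl'
    have h1 : m + 1 ≤ l * (m + 1) := Nat.le_mul_of_pos_left _ hl.1
    have h2 : m + 1 ≤ l' * (m + 1) := Nat.le_mul_of_pos_left _ hl'.1
    rcases lt_trichotomy l l' with hlt | rfl | hlt
    · have := add_le_mul_of_lt m hlt
      split_ifs at h <;> omega
    · split_ifs at h <;> omega
    · have := add_le_mul_of_lt m hlt
      split_ifs at h <;> omega

theorem facetComplement_subset {n m a k j : ℕ} (hn : n + 1 = k * (m + 1) + a)
    (ha0 : 1 ≤ a) (ha : a + 1 < m) (hjk : j + 1 ≤ k) :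
    facetComplement m a k j ⊆ Finset.Icc 1 n := by
  intro x hx
  rw [mem_facetComplement hjk] at hx
  obtain ⟨l, h1, h2, h⟩ := hx
  have h3 : m + 1 ≤ l * (m + 1) := Nat.le_mul_of_pos_left _ h1
  rw [Finset.mem_Icc]
  rcases h2.eq_or_lt with rfl | h2
  · omega
  · have := add_le_mul_of_lt m h2
    omega

/-- Every pruned window meets `facetComplement`. -/
theorem exists_mem_facetComplement_of_window {n m a k j e : ℕ} (hm : 2 ≤ m)
    (hn : n + 1 = k * (m + 1) + a) (ha : a + 1 < m) (hjk : j + 1 ≤ k)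
    (he : m ≤ e) (hen : e ≤ n) :
    ∃ c ∈ facetComplement m a k j, c ∈ prunedWindow m (j * (m + 1) - 1) e := by
  obtain ⟨l, hl⟩ : ∃ l, l = (e + 1) / (m + 1) := ⟨_, rfl⟩
  have h1 : l * (m + 1) ≤ e + 1 := hl ▸ Nat.div_mul_le_self _ _
  have h2 : e + 1 < l * (m + 1) + (m + 1) := by
    rw [hl]
    exact Nat.lt_div_mul_add m.succ_pos
  have h3 : 1 ≤ l := hl ▸ Nat.div_pos (by omega) m.succ_pos
  have h4 : l ≤ k := by
    by_contra! h
    have := add_le_mul_of_lt m h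
    omega
  have h5 : m + 1 ≤ l * (m + 1) := Nat.le_mul_of_pos_left _ h3
  simp only [mem_facetComplement hjk, mem_prunedWindow]
  rcases Nat.lt_or_ge l j with h6 | h6
  · rcases Nat.lt_or_ge (e + 2) (l * (m + 1) + m) with h7 | h7
    · refine ⟨l * (m + 1) - 2, ⟨l, by omega, by omega, by omega⟩, by omega, fun _ hd => ?_⟩
      have := Nat.dvd_sub (Dvd.intro_left l rfl) hd
      rw [show l * (m + 1) - (l * (m + 1) - 2 + 1) = 1 by omega, Nat.dvd_one] at this
      omega
    · refine ⟨l * (m + 1), ⟨l, by omega, by omega, by omega⟩, by omega, fun _ hd => ?_⟩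
      have := (Nat.dvd_add_right (Dvd.intro_left l rfl)).mp hd
      rw [Nat.dvd_one] at this
      omega
  · have h7 : j * (m + 1) ≤ l * (m + 1) := Nat.mul_le_mul_right _ h6
    have h8 : l = k → l * (m + 1) = k * (m + 1) := by rintro rfl; rfl
    rcases Nat.lt_or_ge e (l * (m + 1) + m - 1) with h9 | h9
    · exact ⟨l * (m + 1) - 1, ⟨l, by omega, by omega, by omega⟩, by omega, by omega⟩
    · exact ⟨l * (m + 1) + a, ⟨l, by omega, by omega, by omega⟩, by omega, by omega⟩

/-- Every element of `facetComplement` is the only one of its elements in some pruned window. -/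
theorem exists_window_of_mem_facetComplement {n m a k j c : ℕ} (hm : 2 ≤ m)
    (hn : n + 1 = k * (m + 1) + a) (ha0 : 1 ≤ a) (ha : a + 1 < m) (hjk : j + 1 ≤ k)
    (hc : c ∈ facetComplement m a k j) :
    c = j * (m + 1) - 1 ∨ ∃ e, m ≤ e ∧ e ≤ n ∧
      ∀ x ∈ facetComplement m a k j, e - m + 1 ≤ x → x ≤ e → x = c := by
  have key : ∀ l, 1 ≤ l → l ≤ k → ∀ e, (∀ l', 1 ≤ l' → l' ≤ k → m + 1 ≤ l' * (m + 1) →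
      ((l' < l ∧ l' * (m + 1) + (m + 1) ≤ l * (m + 1)) ∨ (l < l' ∧
      l * (m + 1) + (m + 1) ≤ l' * (m + 1)) ∨ (l = l' ∧ l' * (m + 1) = l * (m + 1))) →
      ∀ x, e - m + 1 ≤ x → x ≤ e → (l' < j ∧ (x = l' * (m + 1) - 2 ∨ x = l' * (m + 1)) ∨
      j ≤ l' ∧ (x = l' * (m + 1) - 1 ∨ l' < k ∧ x = l' * (m + 1) + a)) → x = c) →
      ∀ x ∈ facetComplement m a k j, e - m + 1 ≤ x → x ≤ e → x = c := by
    intro l hl hlk e h x hx hx1 hx2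
    rw [mem_facetComplement hjk] at hx
    obtain ⟨l', h1, h2, h3⟩ := hx
    refine h l' h1 h2 (Nat.le_mul_of_pos_left _ h1) ?_ x hx1 hx2 h3
    rcases lt_trichotomy l l' with hlt | rfl | hlt
    · exact Or.inr (Or.inl ⟨hlt, add_le_mul_of_lt m hlt⟩)
    · exact Or.inr (Or.inr ⟨rfl, rfl⟩)
    · exact Or.inl ⟨hlt, add_le_mul_of_lt m hlt⟩
  rw [mem_facetComplement hjk] at hc
  obtain ⟨l, h1, h2, h⟩ := hc
  have hlm : m + 1 ≤ l * (m + 1) := Nat.le_mul_of_pos_left _ h1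
  have hlk : l < k → l * (m + 1) + (m + 1) ≤ k * (m + 1) := add_le_mul_of_lt m
  have hlk' : l * (m + 1) ≤ k * (m + 1) := Nat.mul_le_mul_right _ h2
  rcases h with ⟨h3, rfl | rfl⟩ | ⟨h3, rfl | ⟨h4, rfl⟩⟩
  · refine Or.inr ⟨l * (m + 1) - 1, by omega, by omega, key l h1 h2 _ ?_⟩
    intro l' h5 h6 h7 h8 x h9 h10 h11
    omega
  · refine Or.inr ⟨l * (m + 1) + m - 2, by omega, by omega, key l h1 h2 _ ?_⟩
    intro l' h5 h6 h7 h8 x h9 h10 h11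
    omega
  · rcases h3.eq_or_lt with rfl | h3
    · exact Or.inl rfl
    refine Or.inr ⟨l * (m + 1) - 1 + a, by omega, by omega, key l h1 h2 _ ?_⟩
    intro l' h5 h6 h7 h8 x h9 h10 h11
    omega
  · refine Or.inr ⟨l * (m + 1) - 1 + m, by omega, by omega, key l h1 h2 _ ?_⟩
    intro l' h5 h6 h7 h8 x h9 h10 h11
    omega

theorem singleton_image_sqfreeIdeal (K : Type*) [Field K] {n : ℕ} {C : Finset ℕ}
    (hC : C ⊆ Finset.Icc 1 n) :
    sqfreeIdeal K n ((fun c => {c}) '' (C : Set ℕ)) =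
      (variablePrime K {i : Fin n | (i : ℕ) + 1 ∈ C}).asIdeal := by
  have hX : ∀ i : Fin n, sqfreeMonomial K n {(i : ℕ) + 1} = X i := by
    intro i
    rw [sqfreeMonomial_eq_prod, show Finset.univ.filter
      (fun l : Fin n => (l : ℕ) + 1 ∈ ({(i : ℕ) + 1} : Finset ℕ)) = {i} by
        ext l; simp [Fin.ext_iff], Finset.prod_singleton]
  rw [sqfreeIdeal, variablePrime]
  congr 1
  ext f
  simp only [Set.mem_image, Finset.mem_coe, Set.mem_ofPred_eq, exists_exists_and_eq_and]
  constructor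
  · rintro ⟨c, hc, rfl⟩
    have := Finset.mem_Icc.mp (hC hc)
    refine ⟨⟨c - 1, by omega⟩, ?_, ?_⟩
    · simpa [Nat.sub_add_cancel this.1] using hc
    · rw [← hX]
      simp [Nat.sub_add_cancel this.1]
  · rintro ⟨i, hi, rfl⟩
    exact ⟨_, hi, hX i⟩

theorem card_filter_succ_mem {n : ℕ} {C : Finset ℕ} (hC : C ⊆ Finset.Icc 1 n) :
    (Finset.univ.filter fun i : Fin n => (i : ℕ) + 1 ∈ C).card = C.card := by
  refine Finset.card_bij (fun i _ => (i : ℕ) + 1) ?_ ?_ ?_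
  · intro i hi
    exact (Finset.mem_filter.mp hi).2
  · intro i _ l _ h
    exact Fin.ext (by omega)
  · intro c hc
    have := Finset.mem_Icc.mp (hC hc)
    exact ⟨⟨c - 1, by omega⟩, by simpa [Nat.sub_add_cancel this.1] using hc, by simp; omega⟩

theorem length_add_card_le_of_isRegular {K : Type*} [Field K] {n : ℕ} {T : Set (Finset ℕ)}
    {C : Finset ℕ} (hC : C ⊆ Finset.Icc 1 n)
    (h : ∀ t ∈ T, ∃ c ∈ C, c ∈ t) (h' : ∀ c ∈ C, ∃ t ∈ T, t ∩ C ⊆ {c} ∧ t ⊆ Finset.Icc 1 n)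
    {rs : List (MvPolynomial (Fin n) K)}
    (hrs : ∀ f ∈ rs, f ∈ Ideal.span (Set.range (X : Fin n → MvPolynomial (Fin n) K)))
    (hreg : RingTheory.Sequence.IsWeaklyRegular (MvPolynomial (Fin n) K ⧸ sqfreeIdeal K n T) rs) :
    rs.length + C.card ≤ n := by
  set P := variablePrime K {i : Fin n | (i : ℕ) + 1 ∈ C} with hP
  have hcolon : ∀ g, g ∈ P.asIdeal ↔
      g * sqfreeMonomial K n (Finset.Icc 1 n \ C) ∈ sqfreeIdeal K n T := by
    rw [hP, ← singleton_image_sqfreeIdeal K hC]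
    refine mul_sqfreeMonomial_mem_sqfreeIdeal_iff ?_ ?_
    · intro t ht
      obtain ⟨c, hc, hct⟩ := h t ht
      refine ⟨_, ⟨c, hc, rfl⟩, ?_⟩
      rw [Finset.singleton_subset_iff, Finset.mem_sdiff, Finset.mem_sdiff]
      exact ⟨hct, fun h => h.2 hc⟩
    · rintro _ ⟨c, hc, rfl⟩
      obtain ⟨t, ht, htC, htn⟩ := h' c hc
      refine ⟨t, ht, fun x hx => htC ?_⟩
      rw [Finset.mem_sdiff, Finset.mem_sdiff] at hx
      rw [Finset.mem_inter]
      exact ⟨hx.1, by_contra fun hxC => hx.2 ⟨htn hx.1, hxC⟩⟩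
  have hass : IsAssociatedPrime P.asIdeal (MvPolynomial (Fin n) K ⧸ sqfreeIdeal K n T) := by
    rw [isAssociatedPrime_iff]
    refine ⟨P.isPrime, Submodule.Quotient.mk (sqfreeMonomial K n (Finset.Icc 1 n \ C)), ?_⟩
    ext g
    rw [hcolon, Submodule.mem_colon_singleton, ← Submodule.Quotient.mk_smul, Submodule.mem_bot,
      Submodule.Quotient.mk_eq_zero, smul_eq_mul]
  obtain ⟨𝔪, h𝔪, hle⟩ := Ideal.exists_le_maximal _ (span_range_X_ne_top K (Fin n))
  have h1 := length_le_coheight_of_isWeaklyRegular 𝔪 rs (fun f hf => hle (hrs f hf)) hreg P hass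
    ((Ideal.span_mono (Set.image_subset_range _ _)).trans hle)
  have h2 := coheight_variablePrime_add_card_le K
    (Finset.univ.filter fun i : Fin n => (i : ℕ) + 1 ∈ C)
  rw [card_filter_succ_mem hC, Finset.coe_filter_univ, ← hP] at h2
  exact_mod_cast (add_le_add_left h1 (C.card : ℕ∞)).trans h2

theorem smul_top_quotient_ne_top {R : Type*} [CommRing R] {I J : Ideal R} (hJ : J ≠ ⊤)
    (h : I ≤ J) : J • (⊤ : Submodule R (R ⧸ I)) ≠ ⊤ := by
  intro heq
  have := Submodule.comap_smul_top_of_surjective J (Submodule.mkQ I) (Submodule.mkQ_surjective I)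
  rw [heq, Submodule.comap_top, Submodule.ker_mkQ, smul_eq_mul, Ideal.mul_top,
    sup_eq_left.mpr h] at this
  exact hJ this.symm

theorem isGreatest_homogRegSeqLengths_prunedWindows (K : Type) [Field K] {n m a k j : ℕ}
    (hm : 2 ≤ m) (hn : n + 1 = k * (m + 1) + a) (ha0 : 1 ≤ a) (ha : a + 1 < m) (hj : 1 ≤ j)
    (hjk : j + 1 ≤ k) :
    IsGreatest (homogRegSeqLengths K n
      (sqfreeIdeal K n (prunedWindows m (j * (m + 1) - 1) n))) (n + 1 - 2 * k) := by
  have hjm : m + 1 ≤ j * (m + 1) := Nat.le_mul_of_pos_left _ hj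
  have hjk' := add_le_mul_of_lt m hjk
  have hC := facetComplement_subset hn ha0 ha hjk
  have hmeet : ∀ t ∈ prunedWindows m (j * (m + 1) - 1) n,
      ∃ c ∈ facetComplement m a k j, c ∈ t :=
    forall_mem_prunedWindows
      ⟨_, (mem_facetComplement hjk).mpr ⟨j, by omega⟩, Finset.mem_singleton_self _⟩
      fun e h1 h2 => exists_mem_facetComplement_of_window hm hn ha hjk h1 h2
  constructor
  · have hle : sqfreeIdeal K n (prunedWindows m (j * (m + 1) - 1) n) ≤
        Ideal.span (Set.range X) := by
      refine le_trans (sqfreeIdeal_mono fun t ht => ?_) ((singleton_image_sqfreeIdeal K hC).trans_le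
        (Ideal.span_mono (Set.image_subset_range _ _)))
      obtain ⟨c, hc, hct⟩ := hmeet t ht
      exact ⟨_, ⟨c, hc, rfl⟩, Finset.singleton_subset_iff.mpr hct⟩
    refine exists_isRegular_isHomogeneous (n + 1 - 2 * k) (ModuleCat.of _ _)
      (smul_top_quotient_ne_top (span_range_X_ne_top K (Fin n)) hle) (Or.inr (by omega))
      fun i hi => hasCodepthLE_prunedWindows K n (by omega) hj
        (Nat.sub_add_cancel (by omega)) n i ?_
    have h1 : (n + 1) / (m + 1) = k := by
      rw [hn, mul_comm, Nat.mul_add_div m.succ_pos, Nat.div_eq_of_lt (by omega), add_zero]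
    have h2 : (n + 1) % (m + 1) = a := by
      rw [hn, mul_comm, Nat.mul_add_mod, Nat.mod_eq_of_lt (by omega)]
    rw [codepthBound, h1, h2, if_neg (by omega), if_neg (by omega)]
    omega
  · rintro d ⟨rs, rfl, hrs, hreg⟩
    have := length_add_card_le_of_isRegular hC hmeet (fun c hc => ?_) (fun f hf => (hrs f hf).2)
      hreg.toIsWeaklyRegular
    · rw [card_facetComplement ha hjk] at this
      omega
    · rcases exists_window_of_mem_facetComplement hm hn ha0 ha hjk hc with rfl | ⟨e, h1, h2, h3⟩
      · refine ⟨_, singleton_mem_prunedWindows _ _ _, Finset.inter_subset_left, ?_⟩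
        rw [Finset.singleton_subset_iff]
        exact hC hc
      · refine ⟨_, prunedWindow_mem_prunedWindows h1 h2, fun x hx => ?_, fun x hx => ?_⟩
        · rw [Finset.mem_inter, mem_prunedWindow] at hx
          rw [Finset.mem_singleton]
          exact h3 x hx.2 hx.1.1.1 hx.1.1.2
        · rw [mem_prunedWindow] at hx
          rw [Finset.mem_Icc]
          omega

/-- For `m ≥ 3`, `n ≥ 2m`, `k = ⌊(n+1)/(m+1)⌋`, `a = n+1-k(m+1)` with `1 < a < m-1`,
and `1 ≤ j ≤ k-1`: with `L_{j-1} = (I_{n,m} : x_m x_{2m+1} ⋯ x_{(j-1)(m+1)-1})` and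
`U_j = L_{j-1} + (x_{j(m+1)-1})`, one has
`depth(S/U_j) = n + 2 − ⌊(n+2)/(m+1)⌋ − ⌈(n+2)/(m+1)⌉`, and in particular
`depth(S/U_j) ≥ n + 1 − ⌊(n+1)/(m+1)⌋ − ⌈(n+1)/(m+1)⌉`. -/
theorem stmt_13 (K : Type) [Field K] (n m : ℕ) (hm : 3 ≤ m) (hn : 2 * m ≤ n)
    (k : ℕ) (hk : k = (n + 1) / (m + 1)) (a : ℕ) (ha : a = n + 1 - k * (m + 1))
    (ha1 : 1 < a) (ha2 : a < m - 1)
    (j : ℕ) (hj : 1 ≤ j) (hjk : j + 1 ≤ k)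
    (U : Ideal (MvPolynomial (Fin n) K))
    (hU : U = (pathIdeal K n m).colon
        (Ideal.span {∏ l ∈ Finset.Icc 1 (j - 1), xv K n (l * (m + 1) - 1)}) +
      Ideal.span {xv K n (j * (m + 1) - 1)}) :
    IsGreatest (homogRegSeqLengths K n U)
      (n + 2 - (n + 2) / (m + 1) - (n + m + 2) / (m + 1)) ∧
    n + 1 - (n + 1) / (m + 1) - (n + m + 1) / (m + 1) ≤
      n + 2 - (n + 2) / (m + 1) - (n + m + 2) / (m + 1) := by
  have hkm : k * (m + 1) ≤ n + 1 := hk ▸ Nat.div_mul_le_self _ _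
  have hn' : n + 1 = k * (m + 1) + a := by omega
  have hjk' := add_le_mul_of_lt m hjk
  have hdiv : ∀ r, r < m + 1 → ∀ q, (q * (m + 1) + r) / (m + 1) = q := by
    intro r hr q
    rw [mul_comm, Nat.mul_add_div m.succ_pos, Nat.div_eq_of_lt hr, add_zero]
  have h1 : (n + 2) / (m + 1) = k := by
    rw [show n + 2 = k * (m + 1) + (a + 1) by omega, hdiv _ (by omega)]
  have h2 : (n + m + 2) / (m + 1) = k + 1 := by
    rw [show n + m + 2 = (k + 1) * (m + 1) + a by linarith, hdiv _ (by omega)]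
  have h3 : (n + m + 1) / (m + 1) = k + 1 := by
    rw [show n + m + 1 = (k + 1) * (m + 1) + (a - 1) by rw [Nat.succ_mul]; omega,
      hdiv _ (by omega)]
  rw [h1, h2, h3, ← hk]
  refine ⟨?_, by omega⟩
  rw [hU, colon_sup_eq_sqfreeIdeal K (by omega) hj (by omega),
    show n + 2 - k - (k + 1) = n + 1 - 2 * k by omega]
  exact isGreatest_homogRegSeqLengths_prunedWindows K (by omega) hn' (by omega) (by omega) hj hjk
end
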